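/- arXiv:1211.6089 — 2 statements merged into one kernel-verified Lean document; each statement's English description precedes it below -/
import Mathlib

section
/- Dehn–Sommerville-like equations for ℱ_{[3]}: for every 0 ≤ k ≤ d+2, h_{d+2−k}(ℱ_{[3]}) = h_k(𝒦_{[3]}). -/
open Finset Pointwise

noncomputable section

/-- The ambient space `ℝ^d`. -/
abbrev Vec (d : ℕ) := Fin d → ℝ

/-- Dimension of a set of points: the dimension of its affine span,
with the convention that the empty set has dimension `-1`. -/
noncomputable def sdim {D : ℕ} (s : Set (Vec D)) : ℤ :=
  open scoped Classical in
  if s = ∅ then -1 else (Module.finrank ℝ (affineSpan ℝ s).direction : ℤ)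

/-- `F` is a proper (nonempty) face of `P`: a nonempty exposed face distinct from `P`. -/
def IsProperFace {D : ℕ} (P F : Set (Vec D)) : Prop :=
  IsExposed ℝ P F ∧ F.Nonempty ∧ F ≠ P

/-- The number of `k`-dimensional (proper, nonempty) faces of `P`. -/
noncomputable def fPoly {D : ℕ} (P : Set (Vec D)) (k : ℤ) : ℕ :=
  Nat.card {F : Set (Vec D) // IsProperFace P F ∧ sdim F = k}

/-- `P` is the (convex) polytope with vertex set `V`. -/
def IsPolytopeWithVertexSet {D : ℕ} (P : Set (Vec D)) (V : Finset (Vec D)) : Prop :=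
  P = convexHull ℝ (V : Set (Vec D)) ∧
    ∀ v ∈ V, v ∉ convexHull ℝ ((V.erase v : Finset (Vec D)) : Set (Vec D))

/-- The (generalized) binomial coefficient `C(a,b)` for integers `a b`, equal to `0`
for `b < 0` (and, in particular, equal to `0` when `b > a ≥ 0`). -/
noncomputable def ch (a b : ℤ) : ℤ := if 0 ≤ b then Ring.choose a b.toNat else 0

/-- The moment curve in `ℝ^m`. -/
def momentCurve (m : ℕ) (t : ℝ) : Vec m := fun i => t ^ ((i : ℕ) + 1)

/-- The cyclic polytope `C_m(N)`: the convex hull of `N` distinct points on the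
moment curve in `ℝ^m`. -/
noncomputable def cyclicPolytope (m N : ℕ) : Set (Vec m) :=
  convexHull ℝ (Set.range fun j : Fin N => momentCurve m ((j : ℕ) + 1))

/-- The upper bound expression for `f_{k-1}(P₁+P₂+P₃)` from Theorem `thm:ms3ub`. -/
noncomputable def UB3 (d : ℕ) (n : Fin 3 → ℕ) (k : ℕ) : ℤ :=
  (fPoly (cyclicPolytope (d + 2) (n 0 + n 1 + n 2)) ((k : ℤ) + 1) : ℤ) -
    (∑ i ∈ Finset.range ((d + 2) / 2 + 1),
      ch ((d : ℤ) + 2 - (i : ℤ)) ((k : ℤ) + 2 - (i : ℤ)) *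
        ∑ S ∈ (Finset.univ : Finset (Fin 3)).powerset.filter
            (fun S => S ≠ ∅ ∧ S ≠ Finset.univ),
          (-1 : ℤ) ^ S.card * ch ((∑ j ∈ S, (n j : ℤ)) - (d : ℤ) - 3 + (i : ℤ)) (i : ℤ)) -
    ((d : ℤ) - 2 * ((d / 2 : ℕ) : ℤ)) *
      ch (((d / 2 : ℕ) : ℤ) + 1) ((k : ℤ) - ((d / 2 : ℕ) : ℤ)) *
      ∑ i : Fin 3, ch ((n i : ℤ) - ((d / 2 : ℕ) : ℤ) - 2) (((d / 2 : ℕ) : ℤ) + 1)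

/-! ### The Cayley construction for three polytopes -/

/-- The standard affine basis of `ℝ²` used in the Cayley embedding. -/
def e2 : Fin 3 → Vec 2 := ![![0, 0], ![1, 0], ![0, 1]]

/-- The Cayley embedding `v ↦ (e_{2,i}, v) ∈ ℝ^{2+d}` of `ℝ^d`. -/
def cayEmb (d : ℕ) (i : Fin 3) (v : Vec d) : Vec (2 + d) := Fin.append (e2 i) v

/-- The number of `k`-dimensional members of a set of faces. -/
noncomputable def fsetCount {D : ℕ} (Y : Set (Set (Vec D))) (k : ℤ) : ℕ :=
  Nat.card {F : Set (Vec D) // F ∈ Y ∧ sdim F = k}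

/-- A set of points which is a (geometric) simplex: the convex hull of an affinely
independent finite set. -/
def IsSimplexSet {D : ℕ} (F : Set (Vec D)) : Prop :=
  ∃ A : Finset (Vec D), AffineIndependent ℝ (fun v : A => (v : Vec D)) ∧
    F = convexHull ℝ (A : Set (Vec D))

/-- Data of three `d`-polytopes in `ℝ^d`, each of dimension `d`,
given by their vertex sets, each having at least `d+1` vertices. -/
structure Cayley3 (d : ℕ) where
  hd : 2 ≤ d
  V : Fin 3 → Finset (Vec d)
  hcard : ∀ i, d + 1 ≤ (V i).card
  hvert : ∀ i, IsPolytopeWithVertexSet (convexHull ℝ ((V i : Set (Vec d)))) (V i)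
  hdim : ∀ i, sdim (convexHull ℝ ((V i : Set (Vec d)))) = (d : ℤ)

namespace Cayley3

variable {d : ℕ} (Γ : Cayley3 d)

/-- The polytope `P i`. -/
noncomputable def P (i : Fin 3) : Set (Vec d) := convexHull ℝ ((Γ.V i : Set (Vec d)))

/-- The Cayley-embedded vertex set `𝒱_i ⊆ ℝ^{2+d}`. -/
noncomputable def VV (i : Fin 3) : Finset (Vec (2 + d)) := (Γ.V i).image (cayEmb d i)

/-- The Cayley polytope `𝒞 = conv(𝒱₁ ∪ 𝒱₂ ∪ 𝒱₃)`. -/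
noncomputable def Cay : Set (Vec (2 + d)) :=
  convexHull ℝ ((↑(Γ.VV 0 ∪ Γ.VV 1 ∪ Γ.VV 2) : Set (Vec (2 + d))))

/-- The Cayley polytope `𝒞_R = conv(∪_{i∈R} 𝒱_i)`. -/
noncomputable def CayR (R : Finset (Fin 3)) : Set (Vec (2 + d)) :=
  convexHull ℝ ((↑(R.biUnion Γ.VV) : Set (Vec (2 + d))))

/-- `ℱ_R`: the set of proper faces of `𝒞` having at least one vertex in each `𝒱_i`, `i ∈ R`. -/
def FSet (R : Finset (Fin 3)) : Set (Set (Vec (2 + d))) :=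
  {F | IsProperFace Γ.Cay F ∧ ∀ i ∈ R, (F ∩ (↑(Γ.VV i) : Set (Vec (2 + d)))).Nonempty}

/-- `𝒦_R`: the closure of `ℱ_R` under taking faces (together with the empty face). -/
def KSet (R : Finset (Fin 3)) : Set (Set (Vec (2 + d))) :=
  {G | G = ∅ ∨ (IsProperFace Γ.Cay G ∧ ∃ F ∈ Γ.FSet R, G ⊆ F)}

/-- The face numbers `f_k(ℱ_R)`, with the conventions `f_{-1}(ℱ_R) = (-1)^{|R|-1}` and
`f_k(ℱ_R) = 0` for `k < -1` or `k > d + |R| - 2`. -/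
noncomputable def fF (R : Finset (Fin 3)) (k : ℤ) : ℤ :=
  if k < -1 ∨ (d : ℤ) + R.card - 2 < k then 0
  else if k = -1 then (-1 : ℤ) ^ (R.card - 1)
  else (fsetCount (Γ.FSet R) k : ℤ)

/-- The face numbers `f_k(𝒦_R)`. -/
noncomputable def fK (R : Finset (Fin 3)) (k : ℤ) : ℤ := (fsetCount (Γ.KSet R) k : ℤ)

/-- `𝒞` is "as simplicial as possible": every proper face of `𝒞` other than the
trivial faces `𝒞_R`, `∅ ⊂ R ⊆ [3]`, is a simplex. -/
def Simplicial : Prop :=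
  ∀ F : Set (Vec (2 + d)), IsProperFace Γ.Cay F →
    (∀ R : Finset (Fin 3), R.Nonempty → F ≠ Γ.CayR R) → IsSimplexSet F

end Cayley3

/-- The `h`-vector associated with an `f`-vector function `fv` and a face set of
maximal dimension `δ`:  `h_k = ∑_{i=0}^{δ+1} (-1)^{k-i} C(δ+1-i, δ+1-k) f_{i-1}`. -/
noncomputable def hF (fv : ℤ → ℤ) (δ : ℤ) (k : ℤ) : ℤ :=
  ∑ i ∈ Finset.range (δ + 2).toNat,
    (-1 : ℤ) ^ (k - (i : ℤ)).natAbs * ch (δ + 1 - (i : ℤ)) (δ + 1 - k) * fv ((i : ℤ) - 1)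

/-- The `m`-order `g`-vector: `g^{(0)} = h` and `g_k^{(m)} = g_k^{(m-1)} - g_{k-1}^{(m-1)}`. -/
noncomputable def gF (fv : ℤ → ℤ) (δ : ℤ) : ℕ → ℤ → ℤ
  | 0 => hF fv δ
  | m + 1 => fun k => gF fv δ m k - gF fv δ m (k - 1)

/-- The link of a vertex `v` in a face set `Y`: the faces `F ∈ Y` not containing `v`
such that the join of `v` and `F` is again in `Y`. -/
def linkv {D : ℕ} (Y : Set (Set (Vec D))) (v : Vec D) : Set (Set (Vec D)) :=
  {F ∈ Y | v ∉ F ∧ convexHull ℝ ({v} ∪ F) ∈ Y}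

/-- The `f`-vector function of a face set. -/
noncomputable def fvOf {D : ℕ} (Y : Set (Set (Vec D))) : ℤ → ℤ :=
  fun k => (fsetCount Y k : ℤ)


section Euler

open Classical in
/-- The Euler characteristic of an integer combination of bounded intervals summing to zero
pointwise vanishes. -/
theorem sum_interval_euler {κ : Type*} (s : Finset κ) (c : κ → ℤ) (o : κ → Bool) (a b : κ → ℝ)
    (hab : ∀ i ∈ s, if o i then a i < b i else a i ≤ b i)
    (h : ∀ t : ℝ, ∑ i ∈ s, c i *
      (if t ∈ (if o i then Set.Ioo (a i) (b i) else Set.Icc (a i) (b i)) then 1 else 0) = 0) :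
    ∑ i ∈ s, c i * (if o i then -1 else 1) = 0 := by
  set T : Finset ℝ := s.image a ∪ s.image b with hT
  obtain ⟨ε, hε, hεT⟩ : ∃ ε > 0, ∀ p ∈ T, ∀ q ∈ T, p < q → p + ε < q := by
    have : ∀ᶠ ε in nhdsWithin (0 : ℝ) (Set.Ioi 0), ∀ p ∈ T, ∀ q ∈ T, p < q → p + ε < q := by
      rw [Filter.eventually_all_finset]
      intro p _
      rw [Filter.eventually_all_finset]
      intro q _
      by_cases hpq : p < q
      · filter_upwards [Ioo_mem_nhdsGT (sub_pos.2 hpq)] with ε hε _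
        linarith [hε.2]
      · exact Filter.Eventually.of_forall fun ε h => absurd h hpq
    obtain ⟨ε, h1, h2⟩ := (this.and self_mem_nhdsWithin).exists
    exact ⟨ε, h2, h1⟩
  have key : ∀ i ∈ s, ∑ t ∈ T,
      ((if t ∈ (if o i then Set.Ioo (a i) (b i) else Set.Icc (a i) (b i)) then (1 : ℤ) else 0) -
        (if t + ε ∈ (if o i then Set.Ioo (a i) (b i) else Set.Icc (a i) (b i)) then 1 else 0))
      = if o i then -1 else 1 := by
    intro i hi
    have ha : a i ∈ T := mem_union_left _ (mem_image_of_mem _ hi)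
    have hb : b i ∈ T := mem_union_right _ (mem_image_of_mem _ hi)
    have hi' := hab i hi
    cases ho : o i
    · simp only [ho, Bool.false_eq_true, if_false] at hi' ⊢
      rw [Finset.sum_eq_single (b i)]
      · rw [if_pos ⟨hi', le_rfl⟩, if_neg (fun h => by linarith [h.2])]; norm_num
      · intro t ht htb
        have : t ∈ Set.Icc (a i) (b i) ↔ t + ε ∈ Set.Icc (a i) (b i) := by
          constructor
          · rintro ⟨h1, h2⟩
            exact ⟨by linarith, (hεT t ht _ hb (lt_of_le_of_ne h2 htb)).le⟩
          · rintro ⟨h1, h2⟩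
            refine ⟨?_, by linarith⟩
            by_contra hlt
            linarith [hεT t ht _ ha (not_le.1 hlt)]
        simp [this]
      · exact fun h => absurd hb h
    · simp only [ho, if_true] at hi' ⊢
      rw [Finset.sum_eq_single (a i)]
      · rw [if_neg (fun h => lt_irrefl _ h.1), if_pos ⟨by linarith, hεT _ ha _ hb hi'⟩]; norm_num
      · intro t ht hta
        have : t ∈ Set.Ioo (a i) (b i) ↔ t + ε ∈ Set.Ioo (a i) (b i) := by
          constructor
          · rintro ⟨h1, h2⟩
            exact ⟨by linarith, hεT t ht _ hb h2⟩
          · rintro ⟨h1, h2⟩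
            refine ⟨?_, by linarith⟩
            by_contra hlt
            linarith [hεT t ht _ ha (lt_of_le_of_ne (not_lt.1 hlt) hta)]
        simp [this]
      · exact fun h => absurd ha h
  rw [Finset.sum_congr rfl fun i hi => by rw [← key i hi, Finset.mul_sum]]
  rw [Finset.sum_comm]
  refine Finset.sum_eq_zero fun t _ => ?_
  simp_rw [mul_sub]
  rw [Finset.sum_sub_distrib, h, h, sub_zero]

variable {ι : Type*}

/-- The vectors of `R` whose coordinates indexed by `A` vanish. -/
def vanishing (R : Submodule ℝ (ι → ℝ)) (A : Finset ι) : Submodule ℝ (ι → ℝ) where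
  carrier := {x | x ∈ R ∧ ∀ i ∈ A, x i = 0}
  add_mem' := fun hx hy => ⟨R.add_mem hx.1 hy.1, fun i hi => by simp [hx.2 i hi, hy.2 i hi]⟩
  zero_mem' := ⟨R.zero_mem, fun _ _ => rfl⟩
  smul_mem' := fun c x hx => ⟨R.smul_mem c hx.1, fun i hi => by simp [hx.2 i hi]⟩

theorem mem_vanishing {R : Submodule ℝ (ι → ℝ)} {A : Finset ι} {x : ι → ℝ} :
    x ∈ vanishing R A ↔ x ∈ R ∧ ∀ i ∈ A, x i = 0 := Iff.rfl

/-- `A` is the zero set of a nonnegative vector of `R`. -/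
def IsZeroSet (R : Submodule ℝ (ι → ℝ)) (A : Finset ι) : Prop :=
  ∃ x ∈ R, (∀ i, 0 ≤ x i) ∧ ∀ i, x i = 0 ↔ i ∈ A

variable [Fintype ι]

/-- The section of `R` by the hyperplane `x j = t * ∑ i, x i`. -/
def hyperSection (R : Submodule ℝ (ι → ℝ)) (j : ι) (t : ℝ) : Submodule ℝ (ι → ℝ) where
  carrier := {x | x ∈ R ∧ x j = t * ∑ i, x i}
  add_mem' := fun hx hy => ⟨R.add_mem hx.1 hy.1, by
    simp [hx.2, hy.2, Finset.sum_add_distrib, mul_add]⟩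
  zero_mem' := ⟨R.zero_mem, by simp⟩
  smul_mem' := fun c x hx => ⟨R.smul_mem c hx.1, by
    simp only [Pi.smul_apply, smul_eq_mul, hx.2, ← Finset.mul_sum]; ring⟩

theorem mem_hyperSection {R : Submodule ℝ (ι → ℝ)} {j : ι} {t : ℝ} {x : ι → ℝ} :
    x ∈ hyperSection R j t ↔ x ∈ R ∧ x j = t * ∑ i, x i := Iff.rfl

theorem hyperSection_le (R : Submodule ℝ (ι → ℝ)) (j : ι) (t : ℝ) : hyperSection R j t ≤ R :=
  fun _ hx => hx.1

theorem vanishing_hyperSection (R : Submodule ℝ (ι → ℝ)) (j : ι) (t : ℝ) (A : Finset ι) :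
    vanishing (hyperSection R j t) A = hyperSection (vanishing R A) j t := by
  ext x; simp only [mem_vanishing, mem_hyperSection]; tauto

theorem finrank_hyperSection_add_one (R : Submodule ℝ (ι → ℝ)) (j : ι) (t : ℝ)
    (h : ∃ x ∈ R, x j ≠ t * ∑ i, x i) :
    Module.finrank ℝ (hyperSection R j t) + 1 = Module.finrank ℝ R := by
  let f : R →ₗ[ℝ] ℝ :=
    ((LinearMap.proj j : (ι → ℝ) →ₗ[ℝ] ℝ) - t • ∑ i, (LinearMap.proj i : (ι → ℝ) →ₗ[ℝ] ℝ)) ∘ₗ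
      R.subtype
  have hf : ∀ x : R, f x = x.1 j - t * ∑ i, x.1 i := fun x => by simp [f]
  have hr : LinearMap.range f = ⊤ := by
    rw [LinearMap.range_eq_top]
    obtain ⟨x, hx, hne⟩ := h
    refine LinearMap.surjective (fun h0 => hne ?_)
    have := hf ⟨x, hx⟩
    rw [h0] at this
    simp only [LinearMap.zero_apply] at this
    linarith
  have hk : (LinearMap.ker f).map R.subtype = hyperSection R j t := by
    ext x
    constructor
    · rintro ⟨y, h1, rfl⟩
      rw [SetLike.mem_coe, LinearMap.mem_ker, hf] at h1
      exact ⟨y.2, sub_eq_zero.1 h1⟩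
    · rintro ⟨h1, h2⟩
      exact ⟨⟨x, h1⟩, by rw [SetLike.mem_coe, LinearMap.mem_ker, hf]; exact sub_eq_zero.2 h2, rfl⟩
  have := LinearMap.finrank_range_add_finrank_ker f
  rw [hr, finrank_top, Module.finrank_self] at this
  rw [← hk, LinearEquiv.finrank_eq (Submodule.equivMapOfInjective R.subtype
    R.injective_subtype (LinearMap.ker f)).symm]
  omega

/-- The cell of the normalized nonnegative part of `R` with zero set `A`,
projected to the `j`-th coordinate. -/
def cellProj (R : Submodule ℝ (ι → ℝ)) (j : ι) (A : Finset ι) : Set ℝ :=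
  {t | ∃ x ∈ R, (∀ i, 0 ≤ x i) ∧ (∀ i, x i = 0 ↔ i ∈ A) ∧ ∑ i, x i = 1 ∧ x j = t}

theorem sum_pos_of_zeroSet_ne_univ {x : ι → ℝ} {A : Finset ι} (hA : A ≠ univ)
    (hx : ∀ i, 0 ≤ x i) (hz : ∀ i, x i = 0 ↔ i ∈ A) : 0 < ∑ i, x i := by
  obtain ⟨i, hi⟩ : ∃ i, i ∉ A := by
    by_contra! h
    exact hA (Finset.eq_univ_of_forall h)
  exact Finset.sum_pos' (fun i _ => hx i)
    ⟨i, mem_univ _, lt_of_le_of_ne (hx i) fun h => hi ((hz i).1 h.symm)⟩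

theorem mem_cellProj_iff {R : Submodule ℝ (ι → ℝ)} {j : ι} {A : Finset ι} (hA : A ≠ univ) (t : ℝ) :
    t ∈ cellProj R j A ↔ IsZeroSet (hyperSection R j t) A := by
  constructor
  · rintro ⟨x, hx, h0, hz, h1, rfl⟩
    exact ⟨x, ⟨hx, by simp [h1]⟩, h0, hz⟩
  · rintro ⟨x, ⟨hx, hj⟩, h0, hz⟩
    have hs := sum_pos_of_zeroSet_ne_univ hA h0 hz
    refine ⟨(∑ i, x i)⁻¹ • x, R.smul_mem _ hx, fun i => ?_, fun i => ?_, ?_, ?_⟩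
    · exact mul_nonneg (inv_nonneg.2 hs.le) (h0 i)
    · simp [hs.ne', hz]
    · simp [← Finset.mul_sum, hs.ne']
    · simp only [Pi.smul_apply, smul_eq_mul, hj]; field_simp

theorem convex_cellProj (R : Submodule ℝ (ι → ℝ)) (j : ι) (A : Finset ι) :
    Convex ℝ (cellProj R j A) := by
  rintro _ ⟨x, hx, hx0, hxz, hx1, rfl⟩ _ ⟨y, hy, hy0, hyz, hy1, rfl⟩ a b ha hb hab
  refine ⟨a • x + b • y, R.add_mem (R.smul_mem _ hx) (R.smul_mem _ hy), fun i => ?_, fun i => ?_,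
    ?_, by simp⟩
  · exact add_nonneg (mul_nonneg ha (hx0 i)) (mul_nonneg hb (hy0 i))
  · constructor
    · intro h
      simp only [Pi.add_apply, Pi.smul_apply, smul_eq_mul] at h
      have h1 := mul_nonneg ha (hx0 i)
      have h2 := mul_nonneg hb (hy0 i)
      rcases ha.eq_or_lt with rfl | ha
      · have hb1 : b = 1 := by linarith
        subst hb1
        exact (hyz i).1 (by linarith)
      · have : a * x i = 0 := by linarith
        exact (hxz i).1 ((mul_eq_zero.1 this).resolve_left ha.ne')
    · intro h
      simp [(hxz i).2 h, (hyz i).2 h]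
  · simp [Finset.sum_add_distrib, ← Finset.mul_sum, hx1, hy1, hab]

theorem cellProj_subset (R : Submodule ℝ (ι → ℝ)) (j : ι) (A : Finset ι) :
    cellProj R j A ⊆ Set.Icc 0 1 := by
  rintro _ ⟨x, hx, hx0, hxz, hx1, rfl⟩
  exact ⟨hx0 j, hx1 ▸ Finset.single_le_sum (fun i _ => hx0 i) (mem_univ j)⟩

theorem isOpen_cellProj {R : Submodule ℝ (ι → ℝ)} {j : ι} {A : Finset ι}
    (h : ∀ t : ℝ, ∃ x ∈ vanishing R A, x j ≠ t * ∑ i, x i) : IsOpen (cellProj R j A) := by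
  rw [isOpen_iff_mem_nhds]
  rintro _ ⟨x, hx, hx0, hxz, hx1, rfl⟩
  obtain ⟨y, hy, hne⟩ := h (x j)
  set z : ι → ℝ := y - (∑ i, y i) • x with hz
  have hzR : z ∈ R := R.sub_mem hy.1 (R.smul_mem _ hx)
  have hzA : ∀ i ∈ A, z i = 0 := fun i hi => by simp [hz, hy.2 i hi, (hxz i).2 hi]
  have hzs : ∑ i, z i = 0 := by
    simp [hz, Finset.sum_sub_distrib, ← Finset.mul_sum, hx1]
  have hzj : z j ≠ 0 := by
    simp only [hz, Pi.sub_apply, Pi.smul_apply, smul_eq_mul]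
    intro h0; apply hne; linarith
  have h1 : ∀ᶠ s in nhds (x j), ∀ i, i ∉ A → 0 < x i + (s - x j) / z j * z i := by
    rw [Filter.eventually_all]
    intro i
    by_cases hi : i ∈ A
    · exact Filter.Eventually.of_forall fun _ h => absurd hi h
    · have hc : ContinuousAt (fun s : ℝ => x i + (s - x j) / z j * z i) (x j) := by fun_prop
      have hp : 0 < x i + (x j - x j) / z j * z i := by
        simpa using lt_of_le_of_ne (hx0 i) fun h => hi ((hxz i).1 h.symm)
      filter_upwards [hc.eventually (lt_mem_nhds hp)] with s hs _ using hs
  filter_upwards [h1] with s hs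
  have hval : ∀ i, (x + ((s - x j) / z j) • z) i = x i + (s - x j) / z j * z i := fun i => by simp
  refine ⟨x + ((s - x j) / z j) • z, R.add_mem hx (R.smul_mem _ hzR), fun i => ?_, fun i => ?_,
    ?_, ?_⟩
  · by_cases hi : i ∈ A
    · simp [hzA i hi, hx0 i]
    · rw [hval]; exact (hs i hi).le
  · by_cases hi : i ∈ A
    · simp [hzA i hi, (hxz i).2 hi, hi]
    · rw [hval]; simp [hi, (hs i hi).ne']
  · simp [Finset.sum_add_distrib, ← Finset.mul_sum, hx1, hzs]
  · rw [hval]; field_simp; ring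

theorem eq_Ioo_of_open_convex {J : Set ℝ} (ho : IsOpen J) (hc : Convex ℝ J) (hn : J.Nonempty)
    (hb : J ⊆ Set.Icc 0 1) : ∃ a b, a < b ∧ J = Set.Ioo a b := by
  have hbb : BddBelow J := ⟨0, fun x hx => (hb hx).1⟩
  have hba : BddAbove J := ⟨1, fun x hx => (hb hx).2⟩
  have hJ : J = Set.Ioo (sInf J) (sSup J) := by
    refine Set.Subset.antisymm (fun x hx => ?_)
      (IsConnected.Ioo_csInf_csSup_subset ⟨hn, hc.isPreconnected⟩ hbb hba)
    obtain ⟨ε, hε, hball⟩ := Metric.isOpen_iff.1 ho x hx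
    rw [Real.ball_eq_Ioo] at hball
    have h1 := csInf_le hbb (hball (show x - ε / 2 ∈ _ from ⟨by linarith, by linarith⟩))
    have h2 := le_csSup hba (hball (show x + ε / 2 ∈ _ from ⟨by linarith, by linarith⟩))
    exact ⟨by linarith, by linarith⟩
  refine ⟨_, _, ?_, hJ⟩
  by_contra h
  rw [Set.Ioo_eq_empty h] at hJ
  exact hn.ne_empty hJ

theorem exists_interval_of_cell {R : Submodule ℝ (ι → ℝ)} {j : ι} {A : Finset ι} (hA : A ≠ univ)
    (hR : IsZeroSet R A) : ∃ (o : Bool) (a b : ℝ), (if o then a < b else a ≤ b) ∧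
      cellProj R j A = (if o then Set.Ioo a b else Set.Icc a b) ∧
      ∀ t ∈ cellProj R j A, (-1 : ℤ) ^ Module.finrank ℝ (vanishing (hyperSection R j t) A) =
        (-1) ^ Module.finrank ℝ (vanishing R A) * (if o then -1 else 1) := by
  obtain ⟨x, hx, hx0, hxz⟩ := hR
  have hs := sum_pos_of_zeroSet_ne_univ hA hx0 hxz
  have hmem : x j / ∑ i, x i ∈ cellProj R j A := by
    rw [mem_cellProj_iff hA]
    exact ⟨x, ⟨hx, by field_simp⟩, hx0, hxz⟩
  by_cases h : ∀ t : ℝ, ∃ x ∈ vanishing R A, x j ≠ t * ∑ i, x i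
  · obtain ⟨a, b, hab, hJ⟩ := eq_Ioo_of_open_convex (isOpen_cellProj h) (convex_cellProj R j A)
      ⟨_, hmem⟩ (cellProj_subset R j A)
    refine ⟨true, a, b, hab, hJ, fun t _ => ?_⟩
    rw [vanishing_hyperSection, ← finrank_hyperSection_add_one _ j t (h t), pow_succ]
    simp
  · push Not at h
    obtain ⟨t₀, ht₀⟩ := h
    have hall : ∀ t ∈ cellProj R j A, t = t₀ := by
      rintro _ ⟨y, hy, hy0, hyz, hy1, rfl⟩
      simpa [hy1] using ht₀ y ⟨hy, fun i hi => (hyz i).2 hi⟩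
    refine ⟨false, t₀, t₀, le_rfl, ?_, fun t ht => ?_⟩
    · rw [hall _ hmem] at hmem
      simp only [Bool.false_eq_true, if_false, Set.Icc_self]
      exact Set.Subset.antisymm (fun t ht => hall t ht) (Set.singleton_subset_iff.2 hmem)
    · rw [hall t ht, vanishing_hyperSection]
      have : hyperSection (vanishing R A) j t₀ = vanishing R A :=
        le_antisymm (hyperSection_le _ _ _) fun y hy => ⟨hy, ht₀ y hy⟩
      rw [this]; simp

theorem exists_Icc_eq_projection {R : Submodule ℝ (ι → ℝ)} (j : ι)
    (hR : ∃ x ∈ R, (∀ i, 0 ≤ x i) ∧ x ≠ 0) :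
    ∃ a b : ℝ, a ≤ b ∧ ∀ t, t ∈ Set.Icc a b ↔
      ∃ x ∈ R, (∀ i, 0 ≤ x i) ∧ ∑ i, x i = 1 ∧ x j = t := by
  set K : Set (ι → ℝ) := (R : Set (ι → ℝ)) ∩ stdSimplex ℝ ι with hK
  have hKc : IsCompact K := (isCompact_stdSimplex ℝ ι).inter_left R.closed_of_finiteDimensional
  have hKconv : Convex ℝ K := R.convex.inter (convex_stdSimplex ℝ ι)
  have hKn : K.Nonempty := by
    obtain ⟨x, hx, hx0, hne⟩ := hR
    have hs : 0 < ∑ i, x i := by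
      refine lt_of_le_of_ne (Finset.sum_nonneg fun i _ => hx0 i) fun h => hne ?_
      funext i
      exact (Finset.sum_eq_zero_iff_of_nonneg fun i _ => hx0 i).1 h.symm i (mem_univ i)
    refine ⟨(∑ i, x i)⁻¹ • x, R.smul_mem _ hx, fun i => mul_nonneg (inv_nonneg.2 hs.le) (hx0 i), ?_⟩
    simp [← Finset.mul_sum, hs.ne']
  have hcont : Continuous fun x : ι → ℝ => x j := continuous_apply j
  have hI := eq_Icc_of_connected_compact
    (⟨hKn.image _, hKconv.isPreconnected.image _ hcont.continuousOn⟩ :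
      IsConnected ((fun x : ι → ℝ => x j) '' K)) (hKc.image hcont)
  refine ⟨_, _, ?_, fun t => by rw [← hI]; simp [hK, stdSimplex, and_assoc]⟩
  obtain ⟨t, ht⟩ := hKn.image (fun x : ι → ℝ => x j)
  rw [hI] at ht
  exact ht.1.trans ht.2

open Classical in
/-- Euler's relation for the nonnegative cone of a subspace of `ℝ^ι`. -/
theorem euler_zeroSets (R : Submodule ℝ (ι → ℝ)) (hR : ∃ x ∈ R, (∀ i, 0 ≤ x i) ∧ x ≠ 0) :
    ∑ A with IsZeroSet R A, (-1 : ℤ) ^ Module.finrank ℝ (vanishing R A) = 0 := by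
  induction hn : Module.finrank ℝ R using Nat.strong_induction_on generalizing R with
  | _ n ih =>
  subst hn
  have huniv : ∀ R : Submodule ℝ (ι → ℝ), IsZeroSet R univ := fun R =>
    ⟨0, R.zero_mem, fun _ => le_rfl, fun i => by simp⟩
  have hvu : ∀ R : Submodule ℝ (ι → ℝ), Module.finrank ℝ (vanishing R univ) = 0 := fun R => by
    have : vanishing R univ = ⊥ := (Submodule.eq_bot_iff _).2 fun x hx =>
      funext fun i => hx.2 i (mem_univ i)
    rw [this, finrank_bot]
  by_cases hj : ∃ j, ∀ t : ℝ, ∃ x ∈ R, x j ≠ t * ∑ i, x i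
  · obtain ⟨j, hj⟩ := hj
    obtain ⟨a₀, b₀, hab₀, hI⟩ := exists_Icc_eq_projection j hR
    have hex : ∀ A : Finset ι, ∃ (o : Bool) (a b : ℝ), IsZeroSet R A →
        (if o then a < b else a ≤ b) ∧
        (∀ t ∈ (if o then Set.Ioo a b else Set.Icc a b), t ∈ Set.Icc a₀ b₀) ∧
        ∀ t ∈ Set.Icc a₀ b₀, (IsZeroSet (hyperSection R j t) A ↔
            t ∈ (if o then Set.Ioo a b else Set.Icc a b)) ∧
          (t ∈ (if o then Set.Ioo a b else Set.Icc a b) →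
          (-1 : ℤ) ^ Module.finrank ℝ (vanishing (hyperSection R j t) A) =
          (-1) ^ Module.finrank ℝ (vanishing R A) * (if o then -1 else 1)) := by
      intro A
      by_cases hA : A = univ
      · refine ⟨false, a₀, b₀, fun _ => ⟨hab₀, fun t ht => by simpa using ht, fun t ht => ?_⟩⟩
        subst hA
        exact ⟨⟨fun _ => by simpa using ht, fun _ => huniv _⟩, fun _ => by simp [hvu]⟩
      · by_cases hAR : IsZeroSet R A
        · obtain ⟨o, a, b, h1, h2, h3⟩ := exists_interval_of_cell (j := j) hA hAR
          refine ⟨o, a, b, fun _ => ?_⟩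
          rw [← h2]
          refine ⟨h1, fun t ht => ?_, fun t _ => ⟨(mem_cellProj_iff hA t).symm, h3 t⟩⟩
          obtain ⟨x, hx, hx0, -, hx1, hxt⟩ := ht
          exact (hI t).2 ⟨x, hx, hx0, hx1, hxt⟩
        · exact ⟨true, 0, 0, fun h => absurd h hAR⟩
    choose o a b hoab using hex
    have main := sum_interval_euler ({A | IsZeroSet R A} : Finset (Finset ι))
      (fun A => (-1 : ℤ) ^ Module.finrank ℝ (vanishing R A) * (if o A then -1 else 1)) o a b
      (fun A hA => (hoab A (by simpa using hA)).1) ?_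
    · rw [← main]
      refine Finset.sum_congr rfl fun A _ => ?_
      cases o A <;> simp
    · intro t
      by_cases ht : t ∈ Set.Icc a₀ b₀
      · obtain ⟨x, hx, hx0, hx1, hxt⟩ := (hI t).1 ht
        refine Eq.trans ?_ (ih _ (by have := finrank_hyperSection_add_one R j t (hj t); omega)
          (hyperSection R j t) ⟨x, ⟨hx, by simp [hx1, hxt]⟩, hx0, by rintro rfl; simp at hx1⟩ rfl)
        rw [Finset.sum_filter, Finset.sum_filter]
        refine Finset.sum_congr rfl fun A _ => ?_
        by_cases hA : IsZeroSet R A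
        · obtain ⟨h1, h2⟩ := (hoab A hA).2.2 t ht
          rw [if_pos hA]
          by_cases hm : t ∈ (if o A then Set.Ioo (a A) (b A) else Set.Icc (a A) (b A))
          · rw [if_pos hm, if_pos (h1.2 hm), h2 hm, mul_one]
          · rw [if_neg (fun h => hm (h1.1 h))]
            exact mul_eq_zero_of_right _ (if_neg hm)
        · rw [if_neg hA, if_neg]
          rintro ⟨y, hy, h⟩
          exact hA ⟨y, hy.1, h⟩
      · refine Finset.sum_eq_zero fun A hA => ?_
        exact mul_eq_zero_of_right _ (if_neg fun h => ht ((hoab A (by simpa using hA)).2.1 t h))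
  · push Not at hj
    obtain ⟨x, hx, hx0, hne⟩ := hR
    choose c hc using hj
    have hs : 0 < ∑ i, x i := by
      refine lt_of_le_of_ne (Finset.sum_nonneg fun i _ => hx0 i) fun h => hne ?_
      funext i
      exact (Finset.sum_eq_zero_iff_of_nonneg fun i _ => hx0 i).1 h.symm i (mem_univ i)
    have hmul : ∀ y ∈ R, y = ((∑ i, y i) / ∑ i, x i) • x := fun y hy => by
      funext i
      simp only [Pi.smul_apply, smul_eq_mul]
      rw [hc i y hy, hc i x hx]; field_simp
    have hR1 : Module.finrank ℝ R = 1 := by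
      have : R = Submodule.span ℝ {x} := by
        refine le_antisymm (fun y hy => ?_) (by simpa using hx)
        rw [hmul y hy]
        exact Submodule.smul_mem _ _ (Submodule.mem_span_singleton_self x)
      rw [this, finrank_span_singleton hne]
    set Z : Finset ι := {i | x i = 0} with hZ
    have hZu : univ ≠ Z := fun h => hne (funext fun i => by
      have : i ∈ Z := h ▸ mem_univ i
      simpa [hZ] using this)
    have hfil : ({A | IsZeroSet R A} : Finset (Finset ι)) = {univ, Z} := by
      ext A
      simp only [mem_filter, mem_univ, true_and, mem_insert, mem_singleton]
      constructor
      · rintro ⟨y, hy, hy0, hyz⟩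
        by_cases hy' : ∑ i, y i = 0
        · left
          have := hmul y hy
          rw [hy', zero_div, zero_smul] at this
          ext i; simp [← hyz, this]
        · right
          ext i
          rw [← hyz i, hmul y hy]
          simp [hZ, hy', hs.ne']
      · rintro (rfl | rfl)
        · exact huniv R
        · exact ⟨x, hx, hx0, fun i => by simp [hZ]⟩
    have hvZ : vanishing R Z = R := by
      refine le_antisymm (fun y hy => hy.1) fun y hy => ⟨hy, fun i hi => ?_⟩
      have : x i = 0 := by simpa [hZ] using hi
      rw [hmul y hy]; simp [this]
    rw [hfil, Finset.sum_pair hZu, hvu, hvZ, hR1]; norm_num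

end Euler

section FaceSets

variable {E : Type*} [AddCommGroup E] [Module ℝ E]

/-- `A` is the set of points of `V` on a supporting hyperplane of `V`
(the cases `A = ∅` and `A = V` are allowed). -/
def IsFaceSet (V A : Finset E) : Prop :=
  A ⊆ V ∧ ∃ (l : E →ₗ[ℝ] ℝ) (c : ℝ), (∀ v ∈ V, l v ≤ c) ∧ ∀ v ∈ V, l v = c ↔ v ∈ A

/-- Evaluation of affine functions on the points of `V`. -/
def affEval (V : Finset E) : ((E →ₗ[ℝ] ℝ) × ℝ) →ₗ[ℝ] (V → ℝ) where
  toFun p v := p.2 - p.1 v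
  map_add' p q := by
    funext v
    simp only [Prod.snd_add, Prod.fst_add, LinearMap.add_apply, Pi.add_apply]
    ring
  map_smul' r p := by
    funext v
    simp only [Prod.smul_snd, Prod.smul_fst, LinearMap.smul_apply, Pi.smul_apply, smul_eq_mul,
      RingHom.id_apply]
    ring

theorem affEval_apply (V : Finset E) (l : E →ₗ[ℝ] ℝ) (c : ℝ) (v : V) :
    affEval V (l, c) v = c - l v := rfl

/-- The restrictions to `V` of affine functions. -/
def affVals (V : Finset E) : Submodule ℝ (V → ℝ) := LinearMap.range (affEval V)

/-- The affine rank of `V`, i.e. one more than the dimension of its affine span. -/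
def affRank (V : Finset E) : ℕ := Module.finrank ℝ (affVals V)

open Classical in
theorem affRank_add_finrank_vanishing {V A : Finset E} (h : A ⊆ V) :
    affRank A + Module.finrank ℝ (vanishing (affVals V) ({v : V | v.1 ∈ A} : Finset V)) =
      affRank V := by
  let f : affVals V →ₗ[ℝ] (A → ℝ) :=
    (LinearMap.funLeft ℝ ℝ (fun a : A => (⟨a.1, h a.2⟩ : V))) ∘ₗ (affVals V).subtype
  have hf : ∀ (x : affVals V) (a : A), f x a = x.1 ⟨a.1, h a.2⟩ := fun _ _ => rfl
  have hr : LinearMap.range f = affVals A := by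
    ext y
    constructor
    · rintro ⟨⟨_, ⟨p, rfl⟩⟩, rfl⟩
      exact ⟨p, rfl⟩
    · rintro ⟨p, rfl⟩
      exact ⟨⟨_, ⟨p, rfl⟩⟩, rfl⟩
  have hk : (LinearMap.ker f).map (affVals V).subtype =
      vanishing (affVals V) ({v : V | v.1 ∈ A} : Finset V) := by
    ext x
    constructor
    · rintro ⟨y, h1, rfl⟩
      refine ⟨y.2, fun i hi => ?_⟩
      have hi : i.1 ∈ A := by simpa using hi
      exact congrFun (LinearMap.mem_ker.1 h1) ⟨i.1, hi⟩
    · rintro ⟨h1, h2⟩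
      exact ⟨⟨x, h1⟩, LinearMap.mem_ker.2 (funext fun a => h2 _ (by simp)), rfl⟩
  have := LinearMap.finrank_range_add_finrank_ker f
  rw [hr] at this
  rw [← hk, LinearEquiv.finrank_eq (Submodule.equivMapOfInjective (affVals V).subtype
    (affVals V).injective_subtype (LinearMap.ker f)).symm]
  exact this

theorem IsFaceSet.restrict [DecidableEq E] {V A B : Finset E} (h : IsFaceSet V A) (hB : B ⊆ V) :
    IsFaceSet B (A ∩ B) := by
  obtain ⟨-, l, c, h1, h2⟩ := h
  exact ⟨inter_subset_right, l, c, fun v hv => h1 v (hB hv), fun v hv => by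
    rw [h2 v (hB hv), mem_inter]; tauto⟩

theorem IsFaceSet.of_subset {V A B : Finset E} (h : IsFaceSet V A) (hA : A ⊆ B) (hB : B ⊆ V) :
    IsFaceSet B A := by
  classical
  have := h.restrict hB
  rwa [inter_eq_left.2 hA] at this

theorem IsFaceSet.trans {V B A : Finset E} (hB : IsFaceSet V B) (hA : IsFaceSet B A) :
    IsFaceSet V A := by
  obtain ⟨hBV, l, c, h1, h2⟩ := hB
  obtain ⟨hAB, m, e, h3, h4⟩ := hA
  have hM : ∀ᶠ M : ℝ in Filter.atTop, ∀ v ∈ V, v ∉ B → m v - e < M * (c - l v) := by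
    rw [Filter.eventually_all_finset]
    intro v hv
    by_cases hvB : v ∈ B
    · exact Filter.Eventually.of_forall fun _ h => absurd hvB h
    · have hpos : 0 < c - l v :=
        sub_pos.2 (lt_of_le_of_ne (h1 v hv) fun h => hvB ((h2 v hv).1 h))
      filter_upwards [Filter.eventually_gt_atTop ((m v - e) / (c - l v))] with M hM _
      rwa [div_lt_iff₀ hpos] at hM
  obtain ⟨M, hM⟩ := hM.exists
  refine ⟨hAB.trans hBV, m + M • l, e + M * c, fun v hv => ?_, fun v hv => ?_⟩
  · simp only [LinearMap.add_apply, LinearMap.smul_apply, smul_eq_mul]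
    by_cases hvB : v ∈ B
    · rw [(h2 v hv).2 hvB]; linarith [h3 v hvB]
    · linarith [hM v hv hvB]
  · simp only [LinearMap.add_apply, LinearMap.smul_apply, smul_eq_mul]
    by_cases hvB : v ∈ B
    · rw [(h2 v hv).2 hvB, ← h4 v hvB, add_left_inj]
    · have := hM v hv hvB
      exact ⟨fun h => by linarith, fun h => absurd (hAB h) hvB⟩

theorem isFaceSet_self (V : Finset E) : IsFaceSet V V :=
  ⟨Subset.rfl, 0, 0, by simp, by simp⟩

theorem isFaceSet_empty (V : Finset E) : IsFaceSet V ∅ :=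
  ⟨empty_subset _, 0, 1, by simp, by simp⟩

open Classical in
theorem isZeroSet_vanishing_iff {V A G : Finset E} (hA : A ⊆ V) (hG : G ⊆ V) :
    IsZeroSet (vanishing (affVals V) ({v : V | v.1 ∈ G} : Finset V))
      ({v : V | v.1 ∈ A} : Finset V) ↔ IsFaceSet V A ∧ G ⊆ A := by
  constructor
  · rintro ⟨_, ⟨⟨⟨l, c⟩, rfl⟩, hv⟩, h0, hz⟩
    simp only [affEval_apply, sub_eq_zero, mem_filter, mem_univ, true_and, Subtype.forall,
      sub_nonneg] at hv h0 hz
    exact ⟨⟨hA, l, c, h0, fun v hv => by rw [← hz v hv, eq_comm]⟩,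
      fun g hg => (hz g (hG hg)).1 (hv g (hG hg) hg)⟩
  · rintro ⟨⟨-, l, c, h1, h2⟩, hGA⟩
    refine ⟨affEval V (l, c), ⟨⟨_, rfl⟩, fun i hi => ?_⟩, fun i => ?_, fun i => ?_⟩
    · rw [affEval_apply, sub_eq_zero, eq_comm, h2 i i.2]
      exact hGA (by simpa using hi)
    · exact sub_nonneg.2 (h1 i i.2)
    · rw [affEval_apply, sub_eq_zero, eq_comm, h2 i i.2]; simp

theorem vanishing_vanishing {ι : Type*} (R : Submodule ℝ (ι → ℝ)) {A G : Finset ι} (h : G ⊆ A) :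
    vanishing (vanishing R G) A = vanishing R A := by
  ext x
  exact ⟨fun hx => ⟨hx.1.1, hx.2⟩, fun hx => ⟨⟨hx.1, fun i hi => hx.2 i (h hi)⟩, hx.2⟩⟩

open Classical in
/-- Euler's relation for the faces of the convex hull of `V` which contain a given face. -/
theorem sum_faceSets_above_eq_zero {V G : Finset E} (hG : IsFaceSet V G) (hne : G ≠ V) :
    ∑ A ∈ V.powerset with IsFaceSet V A ∧ G ⊆ A, (-1 : ℤ) ^ affRank A = 0 := by
  have hpos : ∃ x ∈ vanishing (affVals V) ({v : V | v.1 ∈ G} : Finset V),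
      (∀ i, 0 ≤ x i) ∧ x ≠ 0 := by
    obtain ⟨x, hx, h0, hz⟩ := (isZeroSet_vanishing_iff hG.1 hG.1).2 ⟨hG, Subset.rfl⟩
    refine ⟨x, hx, h0, ?_⟩
    rintro rfl
    refine hne (hG.1.antisymm fun v hv => ?_)
    simpa using (hz ⟨v, hv⟩).1 rfl
  have main := euler_zeroSets _ hpos
  have hsum : ∑ A ∈ V.powerset with IsFaceSet V A ∧ G ⊆ A, (-1 : ℤ) ^ affRank A =
      (-1) ^ affRank V * ∑ B with IsZeroSet
        (vanishing (affVals V) ({v : V | v.1 ∈ G} : Finset V)) B,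
        (-1 : ℤ) ^ Module.finrank ℝ
          (vanishing (vanishing (affVals V) ({v : V | v.1 ∈ G} : Finset V)) B) := by
    rw [Finset.mul_sum]
    refine Finset.sum_bij' (fun A _ => ({v : V | v.1 ∈ A} : Finset V))
      (fun B _ => B.map (Function.Embedding.subtype _)) ?_ ?_ ?_ ?_ ?_
    · intro A hA
      simp only [mem_filter, mem_powerset, mem_univ, true_and] at hA ⊢
      exact (isZeroSet_vanishing_iff hA.1 hG.1).2 hA.2
    · intro B hB
      have hBV : B.map (Function.Embedding.subtype _) ⊆ V := fun v hv => by
        obtain ⟨w, -, rfl⟩ := mem_map.1 hv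
        exact w.2
      simp only [mem_filter, mem_powerset, mem_univ, true_and] at hB ⊢
      refine ⟨hBV, (isZeroSet_vanishing_iff hBV hG.1).1 ?_⟩
      convert hB using 1
      ext v; simp
    · intro A hA
      simp only [mem_filter, mem_powerset] at hA
      ext v
      simp only [mem_map, mem_filter, mem_univ, true_and, Function.Embedding.coe_subtype,
        Subtype.exists, exists_and_right, exists_eq_right, exists_prop]
      exact ⟨fun h => h.2, fun h => ⟨hA.1 h, h⟩⟩
    · intro B _
      ext v; simp
    · intro A hA
      simp only [mem_filter, mem_powerset] at hA
      rw [vanishing_vanishing]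
      · have h := affRank_add_finrank_vanishing hA.1
        rw [← h, pow_add, mul_assoc, ← pow_add, Even.neg_one_pow ⟨_, rfl⟩, mul_one]
      · intro v hv
        simp only [mem_filter, mem_univ, true_and] at hv ⊢
        exact hA.2.2 hv
  rw [hsum, main, mul_zero]

theorem affRank_empty : affRank (∅ : Finset E) = 0 := by
  unfold affRank
  exact Module.finrank_zero_of_subsingleton

theorem affRank_eq_finrank_vectorSpan_add_one [FiniteDimensional ℝ E] {A : Finset E}
    (hA : A.Nonempty) : affRank A = Module.finrank ℝ (vectorSpan ℝ (A : Set E)) + 1 := by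
  obtain ⟨a, ha⟩ := hA
  set S := vectorSpan ℝ (A : Set E) with hS
  have hmem : ∀ v : A, v.1 - a ∈ S := fun v => vsub_mem_vectorSpan ℝ v.2 ha
  let g : (Module.Dual ℝ S × ℝ) →ₗ[ℝ] (A → ℝ) :=
    { toFun := fun p v => p.2 - p.1 ⟨v.1 - a, hmem v⟩
      map_add' := fun p q => by
        funext v
        simp only [Prod.snd_add, Prod.fst_add, LinearMap.add_apply, Pi.add_apply]
        ring
      map_smul' := fun r p => by
        funext v
        simp only [Prod.smul_snd, Prod.smul_fst, LinearMap.smul_apply, Pi.smul_apply,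
          smul_eq_mul, RingHom.id_apply]
        ring }
  have hg : ∀ φ c v, g (φ, c) v = c - φ ⟨v.1 - a, hmem v⟩ := fun _ _ _ => rfl
  have hinj : LinearMap.ker g = ⊥ := by
    rw [LinearMap.ker_eq_bot']
    rintro ⟨φ, c⟩ h
    have hc : c = 0 := by
      have := congrFun h ⟨a, ha⟩
      rw [hg] at this
      have h0 : (⟨a - a, hmem ⟨a, ha⟩⟩ : S) = 0 := Subtype.ext (sub_self a)
      rw [h0, map_zero, sub_zero] at this
      exact this
    subst hc
    have hφ : ∀ v : A, φ ⟨v.1 - a, hmem v⟩ = 0 := fun v => by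
      have := congrFun h v
      rw [hg] at this
      simpa using this
    have hker : S ≤ (LinearMap.ker φ).map S.subtype := by
      conv_lhs => rw [hS, vectorSpan_eq_span_vsub_set_right ℝ ha]
      rw [Submodule.span_le]
      rintro _ ⟨v, hv, rfl⟩
      exact ⟨⟨v - a, hmem ⟨v, hv⟩⟩, hφ ⟨v, hv⟩, rfl⟩
    have : φ = 0 := by
      ext x
      obtain ⟨y, hy, hyx⟩ := hker x.2
      have : y = x := Subtype.ext hyx
      subst this
      exact hy
    rw [this]; rfl
  have hrange : LinearMap.range g = affVals A := by
    ext y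
    constructor
    · rintro ⟨⟨φ, c⟩, rfl⟩
      obtain ⟨l, hl⟩ := LinearMap.exists_extend φ
      refine ⟨(l, c + l a), funext fun v => ?_⟩
      rw [hg, affEval_apply, ← hl]
      simp only [LinearMap.comp_apply, Submodule.subtype_apply, map_sub]
      ring
    · rintro ⟨⟨l, c⟩, rfl⟩
      refine ⟨(l ∘ₗ S.subtype, c - l a), funext fun v => ?_⟩
      rw [hg, affEval_apply]
      simp only [LinearMap.comp_apply, Submodule.subtype_apply, map_sub]
      ring
  unfold affRank
  rw [← hrange, LinearMap.finrank_range_of_inj (LinearMap.ker_eq_bot.1 hinj),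
    Module.finrank_prod, Subspace.dual_finrank_eq, Module.finrank_self]

theorem affRank_of_affineIndependent [FiniteDimensional ℝ E] {A : Finset E}
    (hA : AffineIndependent ℝ (fun v : A => (v : E))) : affRank A = A.card := by
  rcases A.eq_empty_or_nonempty with rfl | hne
  · rw [affRank_empty, card_empty]
  · rw [affRank_eq_finrank_vectorSpan_add_one hne]
    have hc := hne.card_pos
    have := hA.finrank_vectorSpan (n := A.card - 1) (by rw [Fintype.card_coe]; omega)
    rw [Subtype.range_coe_subtype, Finset.setOfPred_mem] at this
    omega

theorem isFaceSet_of_affineIndependent [FiniteDimensional ℝ E] {A B : Finset E}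
    (hA : AffineIndependent ℝ (fun v : A => (v : E))) (hB : B ⊆ A) : IsFaceSet A B := by
  classical
  have htop : affVals A = ⊤ := by
    apply Submodule.eq_top_of_finrank_eq
    rw [Module.finrank_fintype_fun_eq_card, Fintype.card_coe]
    exact affRank_of_affineIndependent hA
  obtain ⟨⟨l, c⟩, hlc⟩ : (fun v : A => if v.1 ∈ B then (0 : ℝ) else 1) ∈ affVals A :=
    htop ▸ Submodule.mem_top
  have hlc' : ∀ v (hv : v ∈ A), c - l v = if v ∈ B then (0 : ℝ) else 1 :=
    fun v hv => congrFun hlc ⟨v, hv⟩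
  refine ⟨hB, l, c, fun v hv => ?_, fun v hv => ?_⟩ <;> have := hlc' v hv <;> split_ifs at this with h
  · linarith
  · linarith
  · exact ⟨fun _ => h, fun _ => by linarith⟩
  · exact ⟨fun _ => by linarith, fun h' => absurd h' h⟩

theorem affRank_lt_of_isFaceSet {V A : Finset E} (h : IsFaceSet V A) (hne : A ≠ V) :
    affRank A < affRank V := by
  classical
  have := affRank_add_finrank_vanishing h.1
  obtain ⟨x, hx, h0, hz⟩ := (isZeroSet_vanishing_iff h.1 h.1).2 ⟨h, Subset.rfl⟩
  have hpos : 0 < Module.finrank ℝ (vanishing (affVals V) ({v : V | v.1 ∈ A} : Finset V)) := by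
    rw [Module.finrank_pos_iff_exists_ne_zero]
    refine ⟨⟨x, hx⟩, fun hx0 => hne (h.1.antisymm fun v hv => ?_)⟩
    have : x = 0 := congrArg Subtype.val hx0
    subst this
    simpa using (hz ⟨v, hv⟩).1 rfl
  omega

theorem mem_convexHull_filter_of_eq [DecidableEq E] {V : Finset E} {l : E →ₗ[ℝ] ℝ} {c : ℝ}
    (hl : ∀ v ∈ V, l v ≤ c) {x : E} (hx : x ∈ convexHull ℝ (V : Set E)) (hlx : l x = c)
    {A : Finset E} (hA : ∀ v ∈ V, l v = c → v ∈ A) :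
    x ∈ convexHull ℝ (A : Set E) := by
  rw [Finset.mem_convexHull'] at hx
  obtain ⟨w, hw0, hw1, rfl⟩ := hx
  have hsum : ∑ v ∈ V, w v * (c - l v) = 0 := by
    simp only [map_sum, map_smul, smul_eq_mul] at hlx
    simp only [mul_sub, Finset.sum_sub_distrib, ← Finset.sum_mul, hw1, hlx]; ring
  have hzero : ∀ v ∈ V, v ∉ A → w v = 0 := by
    intro v hv hvA
    have h := (Finset.sum_eq_zero_iff_of_nonneg
      (fun v hv => mul_nonneg (hw0 v hv) (sub_nonneg.2 (hl v hv)))).1 hsum v hv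
    refine (mul_eq_zero.1 h).resolve_right fun h => hvA (hA v hv ?_)
    linarith
  have hsub : V.filter (· ∈ A) ⊆ V := filter_subset _ _
  have h1 : ∑ v ∈ V.filter (· ∈ A), w v = 1 := by
    rw [← hw1]
    exact Finset.sum_subset hsub fun v hv hv' => hzero v hv fun h => hv' (mem_filter.2 ⟨hv, h⟩)
  have h2 : ∑ v ∈ V.filter (· ∈ A), w v • v = ∑ v ∈ V, w v • v :=
    Finset.sum_subset hsub fun v hv hv' => by
      rw [hzero v hv fun h => hv' (mem_filter.2 ⟨hv, h⟩), zero_smul]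
  rw [← h2]
  exact (convex_convexHull ℝ _).sum_mem (fun v hv => hw0 v (hsub hv)) h1
    fun v hv => subset_convexHull ℝ _ (mem_filter.1 hv).2

theorem le_of_mem_convexHull {V : Set E} {l : E →ₗ[ℝ] ℝ} {c : ℝ} (hl : ∀ v ∈ V, l v ≤ c) {x : E}
    (hx : x ∈ convexHull ℝ V) : l x ≤ c :=
  convexHull_min (show V ⊆ {x | l x ≤ c} from hl) (convex_halfSpace_le l.isLinear c) hx

theorem IsFaceSet.mem_of_mem_convexHull {V A : Finset E} (h : IsFaceSet V A) {v : E} (hv : v ∈ V)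
    (hvA : v ∈ convexHull ℝ (A : Set E)) : v ∈ A := by
  obtain ⟨hAV, l, c, h1, h2⟩ := h
  rw [← h2 v hv]
  refine le_antisymm (h1 v hv) ?_
  have := le_of_mem_convexHull (l := -l) (c := -c) (V := (A : Set E))
    (fun a ha => by simp [(h2 a (hAV ha)).2 ha]) hvA
  simpa using this

theorem IsFaceSet.convexHull_inter {V A B : Finset E} (h : IsFaceSet V A) (hB : B ⊆ V)
    [DecidableEq E] {x : E} (hxA : x ∈ convexHull ℝ (A : Set E))
    (hxB : x ∈ convexHull ℝ (B : Set E)) : x ∈ convexHull ℝ ((A ∩ B : Finset E) : Set E) := by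
  obtain ⟨hAV, l, c, h1, h2⟩ := h
  refine mem_convexHull_filter_of_eq (l := l) (c := c) (fun v hv => h1 v (hB hv)) hxB ?_
    fun v hv hlv => mem_inter.2 ⟨(h2 v (hB hv)).1 hlv, hv⟩
  refine le_antisymm (le_of_mem_convexHull (V := (A : Set E)) (fun a ha => h1 a (hAV ha)) hxA) ?_
  have := le_of_mem_convexHull (l := -l) (c := -c) (V := (A : Set E))
    (fun a ha => by simp [(h2 a (hAV ha)).2 ha]) hxA
  simpa using this

end FaceSets

section ExposedFaces

variable {D : ℕ}

theorem IsFaceSet.isExposed {V A : Finset (Vec D)} (h : IsFaceSet V A) :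
    IsExposed ℝ (convexHull ℝ (V : Set (Vec D))) (convexHull ℝ (A : Set (Vec D))) := by
  classical
  obtain ⟨hAV, l, c, h1, h2⟩ := h
  rintro ⟨x₀, hx₀⟩
  have hge : ∀ x ∈ convexHull ℝ (A : Set (Vec D)), c ≤ l x := fun x hx => by
    have := le_of_mem_convexHull (l := -l) (c := -c) (V := (A : Set (Vec D)))
      (fun a ha => by simp [(h2 a (hAV ha)).2 ha]) hx
    simpa using this
  have hsub := convexHull_mono (𝕜 := ℝ) (Finset.coe_subset.2 hAV)
  refine ⟨LinearMap.toContinuousLinearMap l, ?_⟩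
  ext x
  simp only [Set.mem_ofPred_eq, LinearMap.coe_toContinuousLinearMap']
  constructor
  · intro hx
    exact ⟨hsub hx, fun y hy => (le_of_mem_convexHull (V := (V : Set (Vec D))) h1 hy).trans (hge x hx)⟩
  · rintro ⟨hx, hmax⟩
    refine mem_convexHull_filter_of_eq h1 hx ?_ fun v hv => (h2 v hv).1
    exact le_antisymm (le_of_mem_convexHull (V := (V : Set (Vec D))) h1 hx)
      ((hge _ hx₀).trans (hmax _ (hsub hx₀)))

open Classical in
theorem exposed_eq_convexHull {V : Finset (Vec D)} {F : Set (Vec D)}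
    (hF : IsExposed ℝ (convexHull ℝ (V : Set (Vec D))) F) (hne : F.Nonempty) :
    IsFaceSet V (V.filter (· ∈ F)) ∧
      F = convexHull ℝ ((V.filter (· ∈ F) : Finset (Vec D)) : Set (Vec D)) := by
  have hconv : Convex ℝ F := hF.convex (convex_convexHull ℝ _)
  obtain ⟨l, hl⟩ := hF hne
  obtain ⟨x₀, hx₀⟩ := hne
  have hx₀' := hx₀
  rw [hl] at hx₀'
  have hV : ∀ v ∈ V, v ∈ convexHull ℝ (V : Set (Vec D)) := fun v hv => subset_convexHull ℝ _ hv
  have hmemF : ∀ v ∈ V, l v = l x₀ ↔ v ∈ F := fun v hv => by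
    conv_rhs => rw [hl]
    exact ⟨fun h => ⟨hV v hv, fun y hy => h ▸ hx₀'.2 y hy⟩,
      fun h => le_antisymm (hx₀'.2 v (hV v hv)) (h.2 x₀ hx₀'.1)⟩
  refine ⟨⟨filter_subset _ _, l.toLinearMap, l x₀, fun v hv => hx₀'.2 v (hV v hv), fun v hv => ?_⟩,
    Set.Subset.antisymm (fun x hx => ?_) (convexHull_min (fun v hv => (mem_filter.1 hv).2) hconv)⟩
  · rw [mem_filter]
    exact ⟨fun h => ⟨hv, (hmemF v hv).1 h⟩, fun h => (hmemF v hv).2 h.2⟩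
  · have hx' := hx
    rw [hl] at hx'
    refine mem_convexHull_filter_of_eq (l := l.toLinearMap) (c := l x₀)
      (fun v hv => hx₀'.2 v (hV v hv)) hx'.1 ?_ fun v hv h => mem_filter.2 ⟨hv, (hmemF v hv).1 h⟩
    exact le_antisymm (hx₀'.2 x hx'.1) (hx'.2 x₀ hx₀'.1)

theorem sdim_convexHull (A : Finset (Vec D)) :
    sdim (convexHull ℝ (A : Set (Vec D))) = (affRank A : ℤ) - 1 := by
  unfold sdim
  rcases A.eq_empty_or_nonempty with rfl | hA
  · simp [affRank_empty]
  · rw [if_neg (by simpa [convexHull_eq_empty] using hA.ne_empty), affineSpan_convexHull,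
      direction_affineSpan, affRank_eq_finrank_vectorSpan_add_one hA]
    push_cast; ring

theorem IsFaceSet.convexHull_injective {V A B : Finset (Vec D)} (hA : IsFaceSet V A)
    (hB : IsFaceSet V B)
    (h : convexHull ℝ (A : Set (Vec D)) = convexHull ℝ (B : Set (Vec D))) : A = B :=
  Finset.Subset.antisymm
    (fun _ hv => hB.mem_of_mem_convexHull (hA.1 hv) (h ▸ subset_convexHull ℝ _ hv))
    (fun _ hv => hA.mem_of_mem_convexHull (hB.1 hv) (h ▸ subset_convexHull ℝ _ hv))

theorem isProperFace_convexHull_iff {V : Finset (Vec D)} (F : Set (Vec D)) :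
    IsProperFace (convexHull ℝ (V : Set (Vec D))) F ↔
      ∃ A : Finset (Vec D), IsFaceSet V A ∧ A.Nonempty ∧ A ≠ V ∧
        F = convexHull ℝ (A : Set (Vec D)) := by
  classical
  constructor
  · rintro ⟨h1, h2, h3⟩
    obtain ⟨h4, h5⟩ := exposed_eq_convexHull h1 h2
    refine ⟨_, h4, ?_, fun h => h3 (h5.trans (by rw [h])), h5⟩
    rw [h5, convexHull_nonempty_iff] at h2
    exact_mod_cast h2
  · rintro ⟨A, h1, h2, h3, rfl⟩
    exact ⟨h1.isExposed, convexHull_nonempty_iff.2 (by exact_mod_cast h2),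
      fun h => h3 (h1.convexHull_injective (isFaceSet_self V) h)⟩

/-- A face of a convexly independent set whose hull is a simplex is affinely independent. -/
theorem affineIndependent_of_isSimplexSet {A : Finset (Vec D)}
    (hA : ∀ v ∈ A, v ∉ convexHull ℝ ((A.erase v : Finset (Vec D)) : Set (Vec D)))
    (h : IsSimplexSet (convexHull ℝ (A : Set (Vec D)))) :
    AffineIndependent ℝ (fun v : A => (v : Vec D)) := by
  obtain ⟨B, hB, hAB⟩ := h
  suffices A = B by rwa [this]
  have hBA : B ⊆ A := fun b hb => by
    obtain ⟨-, l, c, h1, h2⟩ := isFaceSet_of_affineIndependent hB (singleton_subset_iff.2 hb)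
    have hAc : ∀ a ∈ A, a ∈ convexHull ℝ (B : Set (Vec D)) := fun a ha =>
      hAB ▸ subset_convexHull ℝ _ ha
    have hb' := mem_convexHull_filter_of_eq (V := A) (l := l) (c := c)
      (fun a ha => le_of_mem_convexHull (V := (B : Set (Vec D))) h1 (hAc a ha))
      (hAB ▸ subset_convexHull ℝ _ hb) ((h2 b hb).2 (mem_singleton_self b))
      (A := A.filter (l · = c)) fun v hv h => mem_filter.2 ⟨hv, h⟩
    obtain ⟨a, ha⟩ := convexHull_nonempty_iff.1 ⟨b, hb'⟩
    obtain ⟨haA, hac⟩ := mem_filter.1 (Finset.mem_coe.1 ha)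
    have := mem_convexHull_filter_of_eq h1 (hAc a haA) hac fun v hv => (h2 v hv).1
    rw [coe_singleton, convexHull_singleton, Set.mem_singleton_iff] at this
    exact this ▸ haA
  refine Finset.Subset.antisymm (fun a ha => ?_) hBA
  by_contra haB
  refine hA a ha (convexHull_mono (s := (B : Set (Vec D))) ?_ (hAB ▸ subset_convexHull ℝ _ ha))
  exact Finset.coe_subset.2 fun b hb => mem_erase.2 ⟨fun h => haB (h ▸ hb), hBA hb⟩

end ExposedFaces
theorem sum_neg_one_pow_choose_mul_choose (i : ℕ) : ∀ D m : ℕ, i ≤ D → m ≤ D →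
    ∑ j ∈ range (i + 1), (-1 : ℤ) ^ j * (i.choose j * (D - j).choose m) =
      (D - i).choose (D - m) := by
  induction i with
  | zero => intro D m _ hm; simp [Nat.choose_symm hm]
  | succ i ih =>
    intro D m hi hm
    obtain ⟨D, rfl⟩ : ∃ D', D = D' + 1 := ⟨D - 1, by omega⟩
    have hrec : ∑ j ∈ range (i + 1 + 1), (-1 : ℤ) ^ j * ((i + 1).choose j * (D + 1 - j).choose m) =
        ∑ j ∈ range (i + 1), (-1 : ℤ) ^ j * (i.choose j * (D + 1 - j).choose m) -
        ∑ j ∈ range (i + 1), (-1 : ℤ) ^ j * (i.choose j * (D - j).choose m) := by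
      have := Finset.sum_choose_succ_mul
        (fun j _ => (-1 : ℤ) ^ j * ((D + 1 - j).choose m : ℤ)) i
      calc _ = _ := Finset.sum_congr rfl fun j _ => by ring
        _ = _ := this
        _ = _ := by
          rw [sub_eq_add_neg, ← Finset.sum_neg_distrib]
          refine congrArg₂ (· + ·) (Finset.sum_congr rfl fun j _ => by ring)
            (Finset.sum_congr rfl fun j _ => ?_)
          rw [Nat.add_sub_add_right]; ring
    rw [hrec, ih (D + 1) m (by omega) hm, Nat.add_sub_add_right]
    rcases hm.eq_or_lt with rfl | hm
    · rw [Finset.sum_eq_zero fun j _ => by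
        rw [Nat.choose_eq_zero_of_lt (show D - j < D + 1 by omega)]; simp]
      simp
    · rw [ih D m (by omega) (by omega), show D + 1 - i = D - i + 1 by omega,
        show D + 1 - m = D - m + 1 by omega, Nat.choose_succ_succ]
      push_cast; ring

theorem sum_choose_mul_eq_of_sum_choose_mul_eq {D : ℕ} {a b : ℕ → ℤ}
    (h : ∀ j ≤ D, (-1) ^ D * b j = ∑ i ∈ range (D + 1), (-1) ^ i * i.choose j * a i)
    {k : ℕ} (hk : k ≤ D) :
    ∑ i ∈ range (D + 1), (-1) ^ (D + k + i) * ((D - i).choose k : ℤ) * a i =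
      ∑ j ∈ range (D + 1), (-1) ^ (k + j) * ((D - j).choose (D - k) : ℤ) * b j := by
  have hb : ∀ j ∈ range (D + 1), (-1) ^ (k + j) * ((D - j).choose (D - k) : ℤ) * b j =
      ∑ i ∈ range (D + 1), (-1) ^ (D + k + i) * a i *
        ((-1) ^ j * (i.choose j * (D - j).choose (D - k))) := fun j hj => by
    have h1 : b j = (-1) ^ D * ((-1) ^ D * b j) := by
      rw [← mul_assoc, ← pow_add, Even.neg_one_pow ⟨_, rfl⟩, one_mul]
    rw [h1, h j (by simpa [Nat.lt_succ_iff] using hj), Finset.mul_sum, Finset.mul_sum]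
    exact Finset.sum_congr rfl fun i _ => by ring
  rw [Finset.sum_congr rfl hb, Finset.sum_comm]
  refine Finset.sum_congr rfl fun i hi => ?_
  have hi : i ≤ D := by simpa [Nat.lt_succ_iff] using hi
  have hid := sum_neg_one_pow_choose_mul_choose i D (D - k) hi (by omega)
  rw [show D - (D - k) = k by omega] at hid
  rw [← Finset.mul_sum, ← Finset.sum_subset (Finset.range_mono (show i + 1 ≤ D + 1 by omega)),
    hid]
  · ring
  · intro j _ hj
    rw [Nat.choose_eq_zero_of_lt (show i < j by simpa using hj)]; simp

theorem hF_natCast (fv : ℤ → ℤ) {D k : ℕ} (hk : k ≤ D) :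
    hF fv ((D : ℤ) - 1) k =
      ∑ i ∈ range (D + 1), (-1) ^ (k + i) * ((D - i).choose (D - k) : ℤ) * fv ((i : ℤ) - 1) := by
  unfold hF
  rw [show ((D : ℤ) - 1 + 2).toNat = D + 1 by omega]
  refine Finset.sum_congr rfl fun i hi => ?_
  have hi : i ≤ D := by simpa [Nat.lt_succ_iff] using hi
  have hs : (-1 : ℤ) ^ ((k : ℤ) - i).natAbs = (-1) ^ (k + i) := by
    rcases Nat.even_or_odd (k + i) with h | h
    · rw [h.neg_one_pow, Even.neg_one_pow (by grind)]
    · rw [h.neg_one_pow, Odd.neg_one_pow (by grind)]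
  rw [hs, show (D : ℤ) - 1 + 1 - i = ((D - i : ℕ) : ℤ) by omega,
    show (D : ℤ) - 1 + 1 - k = ((D - k : ℕ) : ℤ) by omega, ch, if_pos (by positivity),
    Int.toNat_natCast, Ring.choose_natCast]

section MixedFaces

variable {E ι : Type*} [AddCommGroup E] [Module ℝ E] [DecidableEq E] [Fintype ι] [DecidableEq ι]

open Classical in
/-- Inclusion–exclusion of Euler's relation, for the faces meeting every one of the
sets `W i`, each union of which is a face. -/
theorem sum_mixedFaces {W : ι → Finset E}
    (hW : ∀ S : Finset ι, IsFaceSet (univ.biUnion W) (S.biUnion W))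
    (hdisj : ∀ i j, i ≠ j → Disjoint (W i) (W j)) {G : Finset E}
    (hG : IsFaceSet (univ.biUnion W) G) (hne : ∀ S : Finset ι, S.Nonempty → G ≠ S.biUnion W) :
    ∑ A ∈ (univ.biUnion W).powerset with
        IsFaceSet (univ.biUnion W) A ∧ G ⊆ A ∧ ∀ i, (A ∩ W i).Nonempty, (-1 : ℤ) ^ affRank A =
      if G = ∅ then (-1) ^ Fintype.card ι else 0 := by
  set V := univ.biUnion W with hV
  have hmeet : ∀ (A : Finset E) (T : Finset ι), A ⊆ V →
      ((∀ i ∈ T, ¬ (A ∩ W i).Nonempty) ↔ A ⊆ (univ \ T).biUnion W) := by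
    intro A T hA
    simp only [Finset.not_nonempty_iff_eq_empty, Finset.eq_empty_iff_forall_notMem, mem_inter,
      not_and]
    constructor
    · intro h a ha
      obtain ⟨i, -, hi⟩ := mem_biUnion.1 (hA ha)
      exact mem_biUnion.2 ⟨i, by simpa using fun hiT => h i hiT a ha hi, hi⟩
    · intro h i hi a ha hai
      obtain ⟨j, hj, haj⟩ := mem_biUnion.1 (h ha)
      have hij : i ≠ j := by rintro rfl; simp [hi] at hj
      exact Finset.disjoint_left.1 (hdisj i j hij) hai haj
  have hind : ∀ A : Finset E, A ⊆ V → (if ∀ i, (A ∩ W i).Nonempty then (1 : ℤ) else 0) =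
      ∑ T : Finset ι, (-1) ^ #T * if A ⊆ (univ \ T).biUnion W then 1 else 0 := by
    intro A hA
    have h1 : (if ∀ i, (A ∩ W i).Nonempty then (1 : ℤ) else 0) =
        ∏ i, ((1 : ℤ) - if ¬ (A ∩ W i).Nonempty then 1 else 0) := by
      have := Finset.prod_boole (s := univ) (p := fun i => (A ∩ W i).Nonempty) (M₀ := ℤ)
      simp only [mem_univ, forall_const] at this
      rw [← this]
      exact Finset.prod_congr rfl fun i _ => by split_ifs <;> simp
    rw [h1, Finset.prod_sub, Finset.powerset_univ]
    refine Finset.sum_congr rfl fun T _ => ?_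
    rw [Finset.prod_const_one, mul_one, Finset.prod_boole]
    simp only [hmeet A T hA]
  have hface : ∀ S : Finset ι,
      ∑ A ∈ V.powerset with (IsFaceSet V A ∧ G ⊆ A) ∧ A ⊆ S.biUnion W, (-1 : ℤ) ^ affRank A =
        if S = ∅ ∧ G = ∅ then 1 else 0 := by
    intro S
    by_cases hGS : G ⊆ S.biUnion W
    · have hset : (V.powerset.filter fun A => (IsFaceSet V A ∧ G ⊆ A) ∧ A ⊆ S.biUnion W) =
          (S.biUnion W).powerset.filter fun A => IsFaceSet (S.biUnion W) A ∧ G ⊆ A := by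
        ext A
        simp only [mem_filter, mem_powerset]
        exact ⟨fun h => ⟨h.2.2, h.2.1.1.of_subset h.2.2 (hW S).1, h.2.1.2⟩,
          fun h => ⟨h.1.trans (hW S).1, ⟨(hW S).trans h.2.1, h.2.2⟩, h.1⟩⟩
      rw [hset]
      rcases S.eq_empty_or_nonempty with rfl | hS
      · rw [biUnion_empty, subset_empty] at hGS
        subst hGS
        simp [isFaceSet_empty, affRank_empty, Finset.filter_singleton]
      · rw [if_neg fun h => hS.ne_empty h.1]
        convert sum_faceSets_above_eq_zero (hG.of_subset hGS (hW S).1) (hne S hS)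
    · rw [Finset.filter_false_of_mem, Finset.sum_empty, if_neg]
      · rintro ⟨-, rfl⟩
        exact hGS (empty_subset _)
      · exact fun A _ h => hGS (h.1.2.trans h.2)
  calc _ = ∑ A ∈ V.powerset with IsFaceSet V A ∧ G ⊆ A,
        (if ∀ i, (A ∩ W i).Nonempty then (1 : ℤ) else 0) * (-1 : ℤ) ^ affRank A := by
        simp only [ite_mul, one_mul, zero_mul]
        rw [← Finset.sum_filter, Finset.filter_filter]
        simp only [and_assoc]
    _ = ∑ A ∈ V.powerset with IsFaceSet V A ∧ G ⊆ A, ∑ T : Finset ι,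
        (-1) ^ #T * if A ⊆ (univ \ T).biUnion W then (-1 : ℤ) ^ affRank A else 0 := by
        refine Finset.sum_congr rfl fun A hA => ?_
        rw [hind A (mem_powerset.1 (mem_filter.1 hA).1), Finset.sum_mul]
        refine Finset.sum_congr rfl fun T _ => ?_
        rw [mul_assoc, ite_mul, one_mul, zero_mul]
    _ = ∑ T : Finset ι, (-1) ^ #T * if univ \ T = ∅ ∧ G = ∅ then 1 else 0 := by
        rw [Finset.sum_comm]
        refine Finset.sum_congr rfl fun T _ => ?_
        rw [← Finset.mul_sum, ← Finset.sum_filter, Finset.filter_filter, hface]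
    _ = _ := by
        rw [Finset.sum_eq_single univ]
        · simp
        · intro T _ hT
          rw [if_neg, mul_zero]
          rintro ⟨h, -⟩
          exact hT (univ_subset_iff.1 (sdiff_eq_empty_iff_subset.1 h))
        · simp

end MixedFaces

namespace Cayley3

variable {d : ℕ} (Γ : Cayley3 d)

/-- The vertex set of the Cayley polytope. -/
def vertices : Finset (Vec (2 + d)) := univ.biUnion Γ.VV

theorem cay_eq : Γ.Cay = convexHull ℝ (Γ.vertices : Set (Vec (2 + d))) := by
  have : Γ.VV 0 ∪ Γ.VV 1 ∪ Γ.VV 2 = Γ.vertices := by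
    ext v
    simp [vertices, Fin.exists_fin_succ]
  rw [Cay, this]

/-- The projection of `ℝ^{2+d}` onto its last `d` coordinates. -/
def lastCoords (d : ℕ) : Vec (2 + d) →ₗ[ℝ] Vec d := LinearMap.funLeft ℝ ℝ (Fin.natAdd 2)

theorem lastCoords_cayEmb (i : Fin 3) (v : Vec d) : lastCoords d (cayEmb d i v) = v :=
  funext fun j => Fin.append_right (e2 i) v j

theorem cayEmb_injective (i : Fin 3) : Function.Injective (cayEmb d i) :=
  Function.LeftInverse.injective (lastCoords_cayEmb i)

theorem exists_affine_cayEmb_eq (d : ℕ) (w : Fin 3 → ℝ) :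
    ∃ (l : Vec (2 + d) →ₗ[ℝ] ℝ) (c : ℝ), ∀ i v, l (cayEmb d i v) = c - w i := by
  refine ⟨(w 0 - w 1) • LinearMap.proj (Fin.castAdd d 0) +
    (w 0 - w 2) • LinearMap.proj (Fin.castAdd d 1), w 0, fun i v => ?_⟩
  simp only [LinearMap.add_apply, LinearMap.smul_apply, LinearMap.proj_apply, cayEmb,
    Fin.append_left, smul_eq_mul]
  fin_cases i <;> simp [e2]

theorem mem_VV {i : Fin 3} {x : Vec (2 + d)} : x ∈ Γ.VV i ↔ ∃ v ∈ Γ.V i, cayEmb d i v = x := by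
  simp [VV]

theorem VV_disjoint {i j : Fin 3} (h : i ≠ j) : Disjoint (Γ.VV i) (Γ.VV j) := by
  obtain ⟨l, c, hl⟩ := exists_affine_cayEmb_eq d (Pi.single i 1)
  refine Finset.disjoint_left.2 fun x hi hj => ?_
  obtain ⟨v, -, rfl⟩ := Γ.mem_VV.1 hi
  obtain ⟨w, -, hw⟩ := Γ.mem_VV.1 hj
  have h1 := hl i v
  rw [← hw, hl j w, Pi.single_eq_same, Pi.single_eq_of_ne h.symm] at h1
  linarith

theorem card_VV (i : Fin 3) : #(Γ.VV i) = #(Γ.V i) :=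
  Finset.card_image_of_injective _ (cayEmb_injective i)

theorem VV_nonempty (i : Fin 3) : (Γ.VV i).Nonempty := by
  rw [← card_pos, card_VV]
  exact (Nat.succ_pos d).trans_le (Γ.hcard i)

theorem isFaceSet_biUnion_VV (S : Finset (Fin 3)) : IsFaceSet Γ.vertices (S.biUnion Γ.VV) := by
  obtain ⟨l, c, hl⟩ := exists_affine_cayEmb_eq d (fun i => if i ∈ S then 0 else 1)
  refine ⟨biUnion_subset_biUnion_of_subset_left _ (subset_univ S), l, c, fun x hx => ?_,
    fun x hx => ?_⟩ <;>
  obtain ⟨i, -, hi⟩ := mem_biUnion.1 hx <;>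
  obtain ⟨v, -, rfl⟩ := Γ.mem_VV.1 hi <;>
  rw [hl]
  · split_ifs <;> linarith
  · have : cayEmb d i v ∈ S.biUnion Γ.VV ↔ i ∈ S := by
      refine ⟨fun h => ?_, fun h => mem_biUnion.2 ⟨i, h, hi⟩⟩
      obtain ⟨j, hj, hv⟩ := mem_biUnion.1 h
      by_contra hiS
      exact Finset.disjoint_left.1 (Γ.VV_disjoint (show i ≠ j by rintro rfl; exact hiS hj)) hi hv
    rw [this]
    split_ifs with h <;> simp [h]

theorem isFaceSet_VV (i : Fin 3) : IsFaceSet Γ.vertices (Γ.VV i) := by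
  simpa using Γ.isFaceSet_biUnion_VV {i}

theorem notMem_convexHull_erase {v : Vec (2 + d)} (hv : v ∈ Γ.vertices) :
    v ∉ convexHull ℝ ((Γ.vertices.erase v : Finset (Vec (2 + d))) : Set (Vec (2 + d))) := by
  intro h
  obtain ⟨i, -, hi⟩ := mem_biUnion.1 hv
  have h1 := (Γ.isFaceSet_VV i).convexHull_inter (erase_subset _ _)
    (subset_convexHull ℝ _ (mem_coe.2 hi)) h
  obtain ⟨u, hu, rfl⟩ := Γ.mem_VV.1 hi
  refine (Γ.hvert i).2 u hu ?_
  have h2 := Set.mem_image_of_mem (lastCoords d) h1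
  rw [LinearMap.image_convexHull, lastCoords_cayEmb] at h2
  refine convexHull_mono ?_ h2
  rintro _ ⟨x, hx, rfl⟩
  obtain ⟨h3, h4⟩ := mem_inter.1 (mem_coe.1 hx)
  obtain ⟨w, hw, rfl⟩ := Γ.mem_VV.1 h3
  rw [lastCoords_cayEmb]
  exact mem_coe.2 (mem_erase.2 ⟨fun h => (mem_erase.1 h4).1 (h ▸ rfl), hw⟩)

theorem eq_zero_of_const_on_vertices {l : Vec (2 + d) →ₗ[ℝ] ℝ} {c : ℝ}
    (h : ∀ x ∈ Γ.vertices, l x = c) : l = 0 ∧ c = 0 := by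
  let inc : Vec d →ₗ[ℝ] Vec (2 + d) :=
    { toFun := fun v => Fin.append 0 v
      map_add' := fun u v => by
        ext j; refine Fin.addCases (fun j => ?_) (fun j => ?_) j <;> simp
      map_smul' := fun r v => by
        ext j; refine Fin.addCases (fun j => ?_) (fun j => ?_) j <;> simp }
  have hinc : ∀ v, inc v = Fin.append 0 v := fun _ => rfl
  have hadd : ∀ i v, cayEmb d i v = cayEmb d i 0 + inc v := fun i v => by
    ext j; refine Fin.addCases (fun j => ?_) (fun j => ?_) j <;> simp [cayEmb, hinc]
  have hV : ∀ i, ∀ v ∈ Γ.V i, l (cayEmb d i 0) + l (inc v) = c := fun i v hv => by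
    rw [← map_add, ← hadd]
    exact h _ (mem_biUnion.2 ⟨i, mem_univ _, Γ.mem_VV.2 ⟨v, hv, rfl⟩⟩)
  have hne : ∀ i, (Γ.V i).Nonempty := fun i =>
    card_pos.1 ((Nat.succ_pos d).trans_le (Γ.hcard i))
  have hspan : vectorSpan ℝ (Γ.V 0 : Set (Vec d)) = ⊤ := by
    apply Submodule.eq_top_of_finrank_eq
    have h1 := Γ.hdim 0
    rw [sdim_convexHull, affRank_eq_finrank_vectorSpan_add_one (hne 0)] at h1
    rw [Module.finrank_fin_fun]
    push_cast at h1
    rw [add_sub_cancel_right] at h1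
    exact_mod_cast h1
  have hl0 : l ∘ₗ inc = 0 := by
    rw [← LinearMap.ker_eq_top, eq_top_iff, ← hspan, vectorSpan, Submodule.span_le]
    rintro _ ⟨u, hu, v, hv, rfl⟩
    have := (hV 0 u hu).trans (hV 0 v hv).symm
    change l (inc (u - v)) = 0
    rw [map_sub, map_sub]
    linarith
  have hl0' : ∀ v, l (inc v) = 0 := LinearMap.congr_fun hl0
  have hbase : ∀ i, l (cayEmb d i 0) = c := fun i => by
    obtain ⟨v, hv⟩ := hne i
    simpa [hl0'] using hV i v hv
  have hc : c = 0 := by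
    rw [← hbase 0, show cayEmb d 0 0 = 0 from ?_, map_zero]
    ext j; refine Fin.addCases (fun j => ?_) (fun j => ?_) j
    · fin_cases j <;> simp [cayEmb, e2]
    · simp [cayEmb]
  refine ⟨LinearMap.ext fun x => ?_, hc⟩
  have hx : x = x (Fin.castAdd d 0) • cayEmb d 1 0 + x (Fin.castAdd d 1) • cayEmb d 2 0 +
      inc (lastCoords d x) := by
    ext j; refine Fin.addCases (fun j => ?_) (fun j => ?_) j
    · fin_cases j <;> simp [cayEmb, e2, hinc]
    · simp [cayEmb, hinc, lastCoords, LinearMap.funLeft_apply]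
  rw [hx, map_add, map_add, map_smul, map_smul, hbase, hbase, hl0', hc]
  simp

theorem affRank_vertices : affRank Γ.vertices = d + 3 := by
  have hinj : Function.Injective (affEval Γ.vertices) := by
    rw [injective_iff_map_eq_zero]
    rintro ⟨l, c⟩ h
    obtain ⟨rfl, rfl⟩ := Γ.eq_zero_of_const_on_vertices (l := l) (c := c) fun x hx => by
      have := congrFun h ⟨x, hx⟩
      rw [affEval_apply, Pi.zero_apply] at this
      linarith
    rfl
  rw [affRank, affVals, LinearMap.finrank_range_of_inj hinj, Module.finrank_prod,
    Module.finrank_self, show Module.finrank ℝ (Vec (2 + d) →ₗ[ℝ] ℝ) = 2 + d from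
      Subspace.dual_finrank_eq.trans (Module.finrank_fin_fun ℝ)]
  omega

end Cayley3

theorem fsetCount_convexHull {D : ℕ} {V : Finset (Vec D)} {𝒜 : Finset (Finset (Vec D))}
    {Y : Set (Set (Vec D))} (hface : ∀ A ∈ 𝒜, IsFaceSet V A) (hrank : ∀ A ∈ 𝒜, affRank A = #A)
    (hY : ∀ F, F ∈ Y ↔ ∃ A ∈ 𝒜, F = convexHull ℝ (A : Set (Vec D))) (k : ℕ) :
    fsetCount Y ((k : ℤ) - 1) = #{A ∈ 𝒜 | #A = k} := by
  have himage : {F | F ∈ Y ∧ sdim F = (k : ℤ) - 1} =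
      (fun A : Finset (Vec D) => convexHull ℝ (A : Set (Vec D))) ''
        (({A ∈ 𝒜 | #A = k} : Finset (Finset (Vec D))) : Set (Finset (Vec D))) := by
    ext F
    simp only [Set.mem_ofPred_eq, hY, coe_filter, Set.mem_image]
    constructor
    · rintro ⟨⟨A, hA, rfl⟩, h⟩
      rw [sdim_convexHull, hrank A hA] at h
      exact ⟨A, ⟨hA, by omega⟩, rfl⟩
    · rintro ⟨A, ⟨hA, hk⟩, rfl⟩
      exact ⟨⟨A, hA, rfl⟩, by rw [sdim_convexHull, hrank A hA, hk]⟩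
  have hinj : Set.InjOn (fun A : Finset (Vec D) => convexHull ℝ (A : Set (Vec D)))
      (({A ∈ 𝒜 | #A = k} : Finset (Finset (Vec D))) : Set (Finset (Vec D))) :=
    fun A hA B hB h => (hface A (mem_filter.1 hA).1).convexHull_injective
      (hface B (mem_filter.1 hB).1) h
  rw [← Set.ncard_coe_finset, ← hinj.ncard_image, ← himage, ← Nat.card_coe_set_eq]
  rfl

namespace Cayley3

variable {d : ℕ} (Γ : Cayley3 d)

open Classical in
/-- The vertex sets of the faces in `ℱ_{[3]}`. -/
def mixedFaces : Finset (Finset (Vec (2 + d))) :=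
  {A ∈ Γ.vertices.powerset | IsFaceSet Γ.vertices A ∧ A ≠ Γ.vertices ∧
    ∀ i, (A ∩ Γ.VV i).Nonempty}

variable {Γ} in
theorem mem_mixedFaces {A : Finset (Vec (2 + d))} :
    A ∈ Γ.mixedFaces ↔ IsFaceSet Γ.vertices A ∧ A ≠ Γ.vertices ∧ ∀ i, (A ∩ Γ.VV i).Nonempty := by
  simp only [mixedFaces, mem_filter, mem_powerset]
  exact ⟨fun h => h.2, fun h => ⟨h.1.1, h⟩⟩

theorem mem_FSet_univ_iff (F : Set (Vec (2 + d))) :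
    F ∈ Γ.FSet univ ↔ ∃ A ∈ Γ.mixedFaces, F = convexHull ℝ (A : Set (Vec (2 + d))) := by
  have hVV : ∀ i, Γ.VV i ⊆ Γ.vertices := fun i => (Γ.isFaceSet_VV i).1
  simp only [FSet, Set.mem_ofPred_eq, cay_eq, isProperFace_convexHull_iff, mem_mixedFaces]
  constructor
  · rintro ⟨⟨A, hA, -, hne, rfl⟩, hmeet⟩
    refine ⟨A, ⟨hA, hne, fun i => ?_⟩, rfl⟩
    obtain ⟨v, hvA, hv⟩ := hmeet i (mem_univ i)
    exact ⟨v, mem_inter.2 ⟨hA.mem_of_mem_convexHull (hVV i hv) hvA, hv⟩⟩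
  · rintro ⟨A, ⟨hA, hne, hmeet⟩, rfl⟩
    refine ⟨⟨A, hA, (hmeet 0).mono inter_subset_left, hne, rfl⟩, fun i _ => ?_⟩
    obtain ⟨v, hv⟩ := hmeet i
    exact ⟨v, subset_convexHull ℝ _ (mem_inter.1 hv).1, (mem_inter.1 hv).2⟩

variable {Γ}

theorem affineIndependent_of_mem_mixedFaces (hsimp : Γ.Simplicial) {A : Finset (Vec (2 + d))}
    (hA : A ∈ Γ.mixedFaces) : AffineIndependent ℝ (fun v : A => (v : Vec (2 + d))) := by
  obtain ⟨hface, hne, hmeet⟩ := mem_mixedFaces.1 hA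
  refine affineIndependent_of_isSimplexSet (fun v hv h => ?_) (hsimp _ ?_ fun R _ h => ?_)
  · exact Γ.notMem_convexHull_erase (hface.1 hv)
      (convexHull_mono (coe_subset.2 (erase_subset_erase v hface.1)) h)
  · exact ((Γ.mem_FSet_univ_iff _).2 ⟨A, hA, rfl⟩).1
  · obtain rfl := hface.convexHull_injective (Γ.isFaceSet_biUnion_VV R) h
    refine hne (congrArg (Finset.biUnion · Γ.VV) (eq_univ_of_forall fun i => ?_))
    obtain ⟨v, hv⟩ := hmeet i
    obtain ⟨hvR, hvi⟩ := mem_inter.1 hv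
    obtain ⟨j, hj, hvj⟩ := mem_biUnion.1 hvR
    by_contra hi
    exact Finset.disjoint_left.1 (Γ.VV_disjoint (show i ≠ j by rintro rfl; exact hi hj)) hvi hvj

theorem card_le_of_mem_mixedFaces (hsimp : Γ.Simplicial) {A : Finset (Vec (2 + d))}
    (hA : A ∈ Γ.mixedFaces) : #A ≤ d + 2 := by
  obtain ⟨hface, hne, -⟩ := mem_mixedFaces.1 hA
  have := affRank_lt_of_isFaceSet hface hne
  rw [affRank_of_affineIndependent (affineIndependent_of_mem_mixedFaces hsimp hA),
    affRank_vertices] at this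
  omega

variable (Γ) in
/-- The vertex sets of the faces in `𝒦_{[3]}`. -/
def mixedClosure : Finset (Finset (Vec (2 + d))) :=
  insert ∅ (Γ.mixedFaces.biUnion powerset)

theorem mem_mixedClosure {G : Finset (Vec (2 + d))} :
    G ∈ Γ.mixedClosure ↔ G = ∅ ∨ ∃ A ∈ Γ.mixedFaces, G ⊆ A := by
  simp [mixedClosure]

theorem isFaceSet_of_mem_mixedClosure (hsimp : Γ.Simplicial) {G : Finset (Vec (2 + d))}
    (hG : G ∈ Γ.mixedClosure) : IsFaceSet Γ.vertices G := by
  rcases mem_mixedClosure.1 hG with rfl | ⟨A, hA, hGA⟩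
  · exact isFaceSet_empty _
  · exact (mem_mixedFaces.1 hA).1.trans
      (isFaceSet_of_affineIndependent (affineIndependent_of_mem_mixedFaces hsimp hA) hGA)

theorem affRank_of_mem_mixedClosure (hsimp : Γ.Simplicial) {G : Finset (Vec (2 + d))}
    (hG : G ∈ Γ.mixedClosure) : affRank G = #G := by
  rcases mem_mixedClosure.1 hG with rfl | ⟨A, hA, hGA⟩
  · rw [affRank_empty, card_empty]
  · exact affRank_of_affineIndependent
      ((affineIndependent_of_mem_mixedFaces hsimp hA).mono (coe_subset.2 hGA))

theorem ne_biUnion_VV_of_mem_mixedClosure (hsimp : Γ.Simplicial) {G : Finset (Vec (2 + d))}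
    (hG : G ∈ Γ.mixedClosure) {S : Finset (Fin 3)} (hS : S.Nonempty) : G ≠ S.biUnion Γ.VV := by
  rintro rfl
  obtain ⟨i, hi⟩ := hS
  have hiS : Γ.VV i ⊆ S.biUnion Γ.VV := subset_biUnion_of_mem Γ.VV hi
  rcases mem_mixedClosure.1 hG with h | ⟨A, hA, hSA⟩
  · obtain ⟨v, hv⟩ := Γ.VV_nonempty i
    simpa [h] using hiS hv
  · have hle := card_le_of_mem_mixedFaces hsimp hA
    have hmeet := (mem_mixedFaces.1 hA).2.2
    have hsum : ∑ j, #(A ∩ Γ.VV j) ≤ #A := by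
      rw [← card_biUnion fun j _ k _ hjk =>
        (Γ.VV_disjoint hjk).mono inter_subset_right inter_subset_right]
      exact card_le_card (biUnion_subset.2 fun j _ => inter_subset_left)
    have hi' : d + 1 ≤ #(A ∩ Γ.VV i) := by
      rw [inter_eq_right.2 (hiS.trans hSA), card_VV]
      exact Γ.hcard i
    have hpos : ∀ j, 1 ≤ #(A ∩ Γ.VV j) := fun j => card_pos.2 (hmeet j)
    have h0 := hpos 0
    have h1 := hpos 1
    have h2 := hpos 2
    rw [Fin.sum_univ_three] at hsum
    fin_cases i <;> simp only [Fin.zero_eta, Fin.mk_one, Fin.reduceFinMk] at hi' <;> omega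

variable (Γ) in
theorem mem_KSet_univ_iff (hsimp : Γ.Simplicial) (F : Set (Vec (2 + d))) :
    F ∈ Γ.KSet univ ↔ ∃ G ∈ Γ.mixedClosure, F = convexHull ℝ (G : Set (Vec (2 + d))) := by
  constructor
  · rintro (rfl | ⟨hproper, F', hF', hsub⟩)
    · exact ⟨∅, mem_mixedClosure.2 (Or.inl rfl), by simp⟩
    · rw [cay_eq, isProperFace_convexHull_iff] at hproper
      obtain ⟨B, hB, -, -, rfl⟩ := hproper
      obtain ⟨A, hA, rfl⟩ := (Γ.mem_FSet_univ_iff F').1 hF'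
      exact ⟨B, mem_mixedClosure.2 (Or.inr ⟨A, hA, fun b hb =>
        (mem_mixedFaces.1 hA).1.mem_of_mem_convexHull (hB.1 hb)
          (hsub (subset_convexHull ℝ _ hb))⟩), rfl⟩
  · rintro ⟨G, hG, rfl⟩
    rcases G.eq_empty_or_nonempty with rfl | hne
    · exact Or.inl (by simp)
    · obtain ⟨A, hA, hGA⟩ := (mem_mixedClosure.1 hG).resolve_left hne.ne_empty
      refine Or.inr ⟨?_, _, (Γ.mem_FSet_univ_iff _).2 ⟨A, hA, rfl⟩,
        convexHull_mono (coe_subset.2 hGA)⟩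
      rw [cay_eq, isProperFace_convexHull_iff]
      refine ⟨G, isFaceSet_of_mem_mixedClosure hsimp hG, hne, ?_, rfl⟩
      rintro rfl
      obtain ⟨hface, hneA, -⟩ := mem_mixedFaces.1 hA
      exact hneA (hface.1.antisymm hGA)

theorem sum_mixedFaces_above (hsimp : Γ.Simplicial) {G : Finset (Vec (2 + d))}
    (hG : G ∈ Γ.mixedClosure) :
    ∑ A ∈ Γ.mixedFaces with G ⊆ A, (-1 : ℤ) ^ #A =
      (-1) ^ (d + 2) - if G = ∅ then 1 else 0 := by
  classical
  have hface := isFaceSet_of_mem_mixedClosure hsimp hG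
  have hsum := sum_mixedFaces Γ.isFaceSet_biUnion_VV (fun i j h => Γ.VV_disjoint h) hface
    fun S hS => ne_biUnion_VV_of_mem_mixedClosure hsimp hG hS
  have hset : (Γ.vertices.powerset.filter fun A =>
      IsFaceSet Γ.vertices A ∧ G ⊆ A ∧ ∀ i, (A ∩ Γ.VV i).Nonempty) =
      insert Γ.vertices (Γ.mixedFaces.filter (G ⊆ ·)) := by
    ext A
    simp only [mem_filter, mem_powerset, mem_insert, mem_mixedFaces]
    constructor
    · rintro ⟨-, h1, h2, h3⟩
      by_cases hA : A = Γ.vertices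
      · exact Or.inl hA
      · exact Or.inr ⟨⟨h1, hA, h3⟩, h2⟩
    · rintro (rfl | ⟨⟨h1, -, h3⟩, h2⟩)
      · refine ⟨Subset.rfl, isFaceSet_self _, hface.1, fun i => ?_⟩
        rw [inter_eq_right.2 (Γ.isFaceSet_VV i).1]
        exact Γ.VV_nonempty i
      · exact ⟨h1.1, h1, h2, h3⟩
  have hsum' : ∑ A ∈ insert Γ.vertices (Γ.mixedFaces.filter (G ⊆ ·)), (-1 : ℤ) ^ affRank A =
      if G = ∅ then (-1) ^ Fintype.card (Fin 3) else 0 := by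
    rw [← hset, ← hsum]
    exact Finset.sum_congr (by congr!) fun _ _ => rfl
  rw [Finset.sum_insert fun h => (mem_mixedFaces.1 (mem_filter.1 h).1).2.1 rfl,
    affRank_vertices, Fintype.card_fin] at hsum'
  rw [Finset.sum_congr rfl fun A hA => by
    rw [← affRank_of_affineIndependent
      (affineIndependent_of_mem_mixedFaces hsimp (mem_filter.1 hA).1)]]
  rw [pow_succ] at hsum'
  split_ifs at hsum' ⊢ <;> linarith

theorem sum_choose_card_mixedFaces (hsimp : Γ.Simplicial) (j : ℕ) :
    ∑ A ∈ Γ.mixedFaces, (-1 : ℤ) ^ #A * (#A).choose j =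
      (-1) ^ (d + 2) * #{G ∈ Γ.mixedClosure | #G = j} - if j = 0 then 1 else 0 := by
  have hcount : ∀ A ∈ Γ.mixedFaces,
      (#{G ∈ Γ.mixedClosure | #G = j ∧ G ⊆ A} : ℤ) = (#A).choose j := fun A hA => by
    rw [← card_powersetCard]
    congr 2
    ext G
    simp only [mem_filter, mem_powersetCard, mem_mixedClosure]
    exact ⟨fun h => ⟨h.2.2, h.2.1⟩, fun h => ⟨Or.inr ⟨A, hA, h.1⟩, h.2, h.1⟩⟩
  calc _ = ∑ A ∈ Γ.mixedFaces, ∑ G ∈ Γ.mixedClosure with #G = j,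
        if G ⊆ A then (-1 : ℤ) ^ #A else 0 := by
        refine Finset.sum_congr rfl fun A hA => ?_
        rw [← hcount A hA, ← Finset.sum_filter, Finset.filter_filter, Finset.sum_const,
          nsmul_eq_mul, mul_comm]
    _ = ∑ G ∈ Γ.mixedClosure with #G = j, ((-1) ^ (d + 2) - if G = ∅ then (1 : ℤ) else 0) := by
        rw [Finset.sum_comm]
        refine Finset.sum_congr rfl fun G hG => ?_
        rw [← Finset.sum_filter, sum_mixedFaces_above hsimp (mem_filter.1 hG).1]
    _ = _ := by
        rw [Finset.sum_sub_distrib, Finset.sum_const, nsmul_eq_mul, mul_comm, Finset.sum_ite_eq']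
        simp only [mem_filter, mem_mixedClosure, true_or, card_empty, true_and, eq_comm]

theorem fF_univ (hsimp : Γ.Simplicial) {i : ℕ} (hi : i ≤ d + 2) :
    Γ.fF univ ((i : ℤ) - 1) =
      #{A ∈ Γ.mixedFaces | #A = i} + if i = 0 then 1 else 0 := by
  rw [fF, card_univ, Fintype.card_fin, if_neg (by push_cast; omega)]
  rcases Nat.eq_zero_or_pos i with rfl | hpos
  · have : Γ.mixedFaces.filter (#· = 0) = ∅ := filter_eq_empty_iff.2 fun A hA h => by
      obtain ⟨v, hv⟩ := (mem_mixedFaces.1 hA).2.2 0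
      simp [card_eq_zero.1 h] at hv
    simp only [this, card_empty, Nat.cast_zero, zero_sub, if_true, zero_add]
    norm_num
  · rw [if_neg (by omega), if_neg (by omega), add_zero,
      fsetCount_convexHull (fun A hA => (mem_mixedFaces.1 hA).1)
        (fun A hA => affRank_of_affineIndependent (affineIndependent_of_mem_mixedFaces hsimp hA))
        Γ.mem_FSet_univ_iff]

theorem fK_univ (hsimp : Γ.Simplicial) (j : ℕ) :
    Γ.fK univ ((j : ℤ) - 1) = #{G ∈ Γ.mixedClosure | #G = j} := by
  rw [fK, fsetCount_convexHull (fun G hG => isFaceSet_of_mem_mixedClosure hsimp hG)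
    (fun G hG => affRank_of_mem_mixedClosure hsimp hG) (Γ.mem_KSet_univ_iff hsimp)]

theorem fK_univ_eq_sum_fF_univ (hsimp : Γ.Simplicial) (j : ℕ) :
    (-1) ^ (d + 2) * Γ.fK univ ((j : ℤ) - 1) =
      ∑ i ∈ range (d + 2 + 1), (-1) ^ i * i.choose j * Γ.fF univ ((i : ℤ) - 1) := by
  have hfiber : ∑ A ∈ Γ.mixedFaces, (-1 : ℤ) ^ #A * (#A).choose j =
      ∑ i ∈ range (d + 2 + 1), (-1 : ℤ) ^ i * i.choose j * #{A ∈ Γ.mixedFaces | #A = i} := by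
    rw [← Finset.sum_fiberwise_of_maps_to (g := card) (t := range (d + 2 + 1))
      fun A hA => mem_range.2 (Nat.lt_succ_of_le (card_le_of_mem_mixedFaces hsimp hA))]
    refine Finset.sum_congr rfl fun i _ => ?_
    rw [mul_comm, ← nsmul_eq_mul]
    exact Finset.sum_eq_card_nsmul fun A hA => by rw [(mem_filter.1 hA).2]
  rw [Finset.sum_congr rfl fun i hi => by
    rw [fF_univ hsimp (Nat.le_of_lt_succ (mem_range.1 hi)), mul_add]]
  rw [Finset.sum_add_distrib, ← hfiber, sum_choose_card_mixedFaces hsimp, fK_univ hsimp]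
  simp only [mul_ite, mul_one, mul_zero, Finset.sum_ite_eq']
  cases j <;> simp

end Cayley3

/-- relation `equ:DSW`: the Dehn–Sommerville-like equations for `ℱ_{[3]}`:
for every `0 ≤ k ≤ d+2`, `h_{d+2-k}(ℱ_{[3]}) = h_k(𝒦_{[3]})`. -/
theorem dehn_sommerville_like_for_F3
    (d : ℕ) (Γ : Cayley3 d) (hsimp : Γ.Simplicial) :
    ∀ k : ℤ, 0 ≤ k → k ≤ (d : ℤ) + 2 →
      hF (Γ.fF Finset.univ) ((d : ℤ) + 1) ((d : ℤ) + 2 - k) =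
        hF (Γ.fK Finset.univ) ((d : ℤ) + 1) k := by
  intro k hk0 hk
  obtain ⟨m, rfl⟩ := Int.eq_ofNat_of_zero_le hk0
  have hm : m ≤ d + 2 := by omega
  have h := sum_choose_mul_eq_of_sum_choose_mul_eq
    (fun j _ => Γ.fK_univ_eq_sum_fF_univ hsimp j) hm
  rw [show (d : ℤ) + 1 = ((d + 2 : ℕ) : ℤ) - 1 by push_cast; ring,
    show (d : ℤ) + 2 - m = ((d + 2 - m : ℕ) : ℤ) by omega, hF_natCast _ (Nat.sub_le _ _),
    hF_natCast _ hm, ← h]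
  refine Finset.sum_congr rfl fun i _ => ?_
  rw [Nat.sub_sub_self hm, show d + 2 + m + i = d + 2 - m + i + 2 * m by omega, pow_add _ _ (2 * m),
    Even.neg_one_pow ⟨m, two_mul m⟩, mul_one]
end
end

section
/- For every 0 ≤ k ≤ d+2, h_k(ℱ_{[3]}) ≤ Σ_{∅⊂S⊆[3]} (−1)^{3−|S|} C(n_S−d−3+k, k), where n_S = Σ_{i∈S} n_i. Moreover, for 0 ≤ k ≤ ⌊(d+2)/2⌋, equality holds if and only if f_{l−1}(ℱ_{[3]}) = Σ_{∅⊂S⊆[3]} (−1)^{3−|S|} C(n_S, l) for all 0 ≤ l ≤ k. -/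
open Finset Pointwise

noncomputable section

theorem exists_pos_weight_ne_zero {V : Type*} [Fintype V] (s : Finset (V → ℝ))
    (hs : ∀ e ∈ s, e ≠ 0) :
    ∃ w : V → ℝ, (∀ v, 0 < w v) ∧ ∀ e ∈ s, ∑ v, w v * e v ≠ 0 := by
  classical
  let p : (V → ℝ) → Polynomial ℝ := fun e =>
    ∑ v, Polynomial.monomial (Fintype.equivFin V v : ℕ) (e v)
  have hp : ∀ e, e ≠ 0 → p e ≠ 0 := by
    intro e he h0
    apply he
    funext v
    have := congrArg (fun q : Polynomial ℝ => q.coeff (Fintype.equivFin V v : ℕ)) h0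
    simpa [p, Polynomial.finsetSum_coeff, Polynomial.coeff_monomial, Fin.val_inj] using this
  obtain ⟨t, ht, htn⟩ := (Set.Ioi_infinite (0 : ℝ)).exists_notMem_finset
    (s.biUnion fun e => (p e).roots.toFinset)
  refine ⟨fun v => t ^ (Fintype.equivFin V v : ℕ), fun v => pow_pos ht _, fun e he h0 => ?_⟩
  apply htn
  simp only [Finset.mem_biUnion, Multiset.mem_toFinset]
  refine ⟨e, he, (Polynomial.mem_roots (hp e (hs e he))).2 ?_⟩
  simp only [Polynomial.IsRoot, p, Polynomial.eval_finsetSum, Polynomial.eval_monomial]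
  rw [← h0]
  exact Finset.sum_congr rfl fun v _ => mul_comm _ _

theorem exists_dotProduct_eq_zero {V : Type*} [Fintype V] {W : Submodule ℝ (V → ℝ)}
    (hW : W ≠ ⊤) : ∃ e : V → ℝ, e ≠ 0 ∧ ∀ a ∈ W, ∑ v, a v * e v = 0 := by
  classical
  obtain ⟨f, hf, hle⟩ := Submodule.exists_le_ker_of_lt_top W hW.lt_top
  have key : ∀ a, f a = ∑ v, a v * f (Pi.single v 1) := fun a => by
    conv_lhs => rw [pi_eq_sum_univ' a]
    simp [map_sum]
  refine ⟨fun v => f (Pi.single v 1), fun h => hf ?_, fun a ha => ?_⟩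
  · ext v
    simpa using congrFun h v
  · rw [← key]
    exact hle ha

theorem exists_move_to_boundary {V : Type*} [Fintype V] {l e : V → ℝ} (hl : 0 ≤ l)
    (hneg : ∃ v, e v < 0) (hz : ∀ v, l v = 0 → 0 ≤ e v) :
    ∃ s : ℝ, 0 < s ∧ 0 ≤ l + s • e ∧ ∃ u, e u < 0 ∧ l u + s * e u = 0 := by
  classical
  obtain ⟨u, hu, hmin⟩ := Finset.exists_min_image (univ.filter fun v => e v < 0)
    (fun v => l v / -e v) (by simpa [Finset.Nonempty] using hneg)
  simp only [mem_filter, mem_univ, true_and] at hu hmin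
  have hlu : 0 < l u := lt_of_le_of_ne (hl u) fun h => absurd (hz u h.symm) (not_le.2 hu)
  have hpos : 0 < l u / -e u := div_pos hlu (neg_pos.2 hu)
  refine ⟨l u / -e u, hpos, fun v => ?_, u, hu, ?_⟩
  · simp only [Pi.zero_apply, Pi.add_apply, Pi.smul_apply, smul_eq_mul]
    rcases lt_or_ge (e v) 0 with hv | hv
    · have := (le_div_iff₀ (neg_pos.2 hv)).1 (hmin v hv)
      linarith
    · have := hl v
      have := mul_nonneg hpos.le hv
      simp only [Pi.zero_apply] at *
      linarith
  · field_simp [hu.ne]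
    ring

/-- No nonzero nonnegative element of `E` vanishes on `L`. -/
def NonFace {V : Type*} (E : Submodule ℝ (V → ℝ)) (L : Finset V) : Prop :=
  ∀ l ∈ E, 0 ≤ l → (∀ v ∈ L, l v = 0) → l = 0

open scoped Classical in
/-- The family of sets satisfying `P` is a disjoint union of intervals `[R, F]` of the Boolean
lattice with `m ≤ |F|`; `w (R, F)` is the multiplicity of the interval. -/
def IntervalPartition {V : Type*} [Fintype V] (m : ℕ) (P : Finset V → Prop)
    (w : Finset V × Finset V → ℕ) : Prop :=
  (∀ j, w j ≠ 0 → j.1 ⊆ j.2 ∧ m ≤ j.2.card) ∧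
    ∀ L, (∑ j, if j.1 ⊆ L ∧ L ⊆ j.2 then w j else 0) = if P L then 1 else 0

/-- `l` is a vertex of the polyhedron of nonnegative elements of `a + E`. -/
structure IsVertexOf {V : Type*} (E : Submodule ℝ (V → ℝ)) (a l : V → ℝ) : Prop where
  sub_mem : l - a ∈ E
  nonneg : 0 ≤ l
  inj : ∀ e ∈ E, (∀ v, l v = 0 → e v = 0) → e = 0

def zeroSet {V : Type*} [Fintype V] (l : V → ℝ) : Finset V :=
  open scoped Classical in univ.filter fun v => l v = 0

theorem mem_zeroSet {V : Type*} [Fintype V] {l : V → ℝ} {v : V} :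
    v ∈ zeroSet l ↔ l v = 0 := by simp [zeroSet]

theorem IsVertexOf.finrank_le {V : Type*} [Fintype V] {E : Submodule ℝ (V → ℝ)}
    {a l : V → ℝ} (h : IsVertexOf E a l) : Module.finrank ℝ E ≤ (zeroSet l).card := by
  let f : E →ₗ[ℝ] (zeroSet l → ℝ) := (LinearMap.funLeft ℝ ℝ Subtype.val).comp E.subtype
  have hf : Function.Injective f := by
    rw [← LinearMap.ker_eq_bot, LinearMap.ker_eq_bot']
    intro e he
    apply Subtype.ext
    exact h.inj e e.2 fun v hv => congrFun he ⟨v, mem_zeroSet.2 hv⟩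
  simpa using LinearMap.finrank_le_finrank_of_injective hf

theorem exists_isVertexOf {V : Type*} [Fintype V] {E : Submodule ℝ (V → ℝ)} {a : V → ℝ}
    {L : Finset V} (hL : NonFace E L)
    (hex : ∃ l, l - a ∈ E ∧ 0 ≤ l ∧ ∀ v ∈ L, l v = 0) :
    ∃ l, IsVertexOf E a l ∧ L ⊆ zeroSet l := by
  classical
  have hS : (univ.filter fun Z : Finset V =>
      ∃ l, l - a ∈ E ∧ 0 ≤ l ∧ (∀ v ∈ L, l v = 0) ∧ zeroSet l = Z).Nonempty := by
    obtain ⟨l, h1, h2, h3⟩ := hex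
    exact ⟨zeroSet l, by simpa using ⟨l, h1, h2, h3, rfl⟩⟩
  obtain ⟨Z, hZ, hmax⟩ := Finset.exists_max_image _ Finset.card hS
  simp only [mem_filter, mem_univ, true_and] at hZ hmax
  obtain ⟨l, h1, h2, h3, rfl⟩ := hZ
  refine ⟨l, ⟨h1, h2, fun e he hez => ?_⟩, fun v hv => mem_zeroSet.2 (h3 v hv)⟩
  by_contra hne
  have hneg : ∃ v, e v < 0 := by
    by_contra! hcon
    exact hne (hL e he hcon fun v hv => hez v (h3 v hv))
  obtain ⟨s, -, hs, u, hu, hsu⟩ := exists_move_to_boundary h2 hneg fun v hv => (hez v hv).ge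
  have hlt : (zeroSet l).card < (zeroSet (l + s • e)).card := by
    refine Finset.card_lt_card ((Finset.ssubset_iff_of_subset fun v hv => ?_).2 ⟨u, ?_, ?_⟩)
    · rw [mem_zeroSet] at *
      simp [hv, hez v hv]
    · rw [mem_zeroSet]
      simpa using hsu
    · rw [mem_zeroSet]
      intro h
      exact hu.ne (hez u h)
  refine absurd (hmax _ ⟨l + s • e, ?_, hs, fun v hv => ?_, rfl⟩) (not_le.2 hlt)
  · rw [add_sub_right_comm]
    exact E.add_mem h1 (E.smul_mem s he)
  · simp [h3 v hv, hez v (h3 v hv)]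

theorem exists_generic {V : Type*} [Fintype V] (E : Submodule ℝ (V → ℝ)) :
    ∃ a : V → ℝ, ∀ S : Finset V, (∃ e ∈ E, ∀ v ∈ S, e v = a v) →
      ∀ b : V → ℝ, ∃ e ∈ E, ∀ v ∈ S, e v = b v := by
  classical
  let W : Finset V → Submodule ℝ (V → ℝ) := fun S =>
    { carrier := {a | ∃ e ∈ E, ∀ v ∈ S, e v = a v}
      zero_mem' := ⟨0, E.zero_mem, fun _ _ => rfl⟩
      add_mem' := by
        rintro a b ⟨e, he, h⟩ ⟨e', he', h'⟩
        exact ⟨e + e', E.add_mem he he', fun v hv => by simp [h v hv, h' v hv]⟩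
      smul_mem' := by
        rintro c a ⟨e, he, h⟩
        exact ⟨c • e, E.smul_mem c he, fun v hv => by simp [h v hv]⟩ }
  have hW : ∀ S, ∃ e : V → ℝ, W S ≠ ⊤ → (e ≠ 0 ∧ ∀ a ∈ W S, ∑ v, a v * e v = 0) := by
    intro S
    by_cases h : W S = ⊤
    · exact ⟨0, fun h' => absurd h h'⟩
    · obtain ⟨e, he⟩ := exists_dotProduct_eq_zero h
      exact ⟨e, fun _ => he⟩
  choose e he using hW
  obtain ⟨a, -, ha⟩ := exists_pos_weight_ne_zero ((univ.filter fun S => W S ≠ ⊤).image e) (by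
    simp only [mem_image, mem_filter, mem_univ, true_and]
    rintro _ ⟨S, hS, rfl⟩
    exact (he S hS).1)
  refine ⟨a, fun S hS b => ?_⟩
  by_cases h : W S = ⊤
  · exact (h ▸ Submodule.mem_top : b ∈ W S)
  · exact absurd ((he S h).2 a hS)
      (ha _ (mem_image_of_mem e (by simpa using h)))

/-- The faces not on the boundary of the regular subdivision induced by generic heights `a`
are partitioned into intervals. -/
theorem exists_intervalPartition_interior {V : Type*} [Fintype V] (E : Submodule ℝ (V → ℝ))
    (a : V → ℝ)
    (ha : ∀ S : Finset V, (∃ e ∈ E, ∀ v ∈ S, e v = a v) →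
      ∀ b : V → ℝ, ∃ e ∈ E, ∀ v ∈ S, e v = b v) :
    ∃ w, IntervalPartition (Module.finrank ℝ E)
      (fun L => NonFace E L ∧ ∃ l, l - a ∈ E ∧ 0 ≤ l ∧ ∀ v ∈ L, l v = 0) w := by
  classical
  let IsF : Finset V → Prop := fun F => ∃ l, IsVertexOf E a l ∧ zeroSet l = F
  have hlF : ∀ F, ∃ l, IsF F → IsVertexOf E a l ∧ zeroSet l = F := fun F => by
    by_cases h : IsF F
    · exact h.imp fun l hl _ => hl
    · exact ⟨0, fun h' => absurd h' h⟩
  choose lF hlF using hlF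
  have hdir : ∀ F u, ∃ e, IsF F → e ∈ E ∧ ∀ v ∈ F, e v = if v = u then 1 else 0 := fun F u => by
    by_cases h : IsF F
    · obtain ⟨l, hl, rfl⟩ := h
      obtain ⟨e, he, h'⟩ := ha (zeroSet l)
        ⟨a - l, by simpa using E.neg_mem hl.sub_mem, fun v hv => by
          simp [mem_zeroSet.1 hv]⟩ (fun v => if v = u then 1 else 0)
      exact ⟨e, fun _ => ⟨he, h'⟩⟩
    · exact ⟨0, fun h' => absurd h' h⟩
  choose dir hdir using hdir
  obtain ⟨w, hw, hwd⟩ := exists_pos_weight_ne_zero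
    ((univ.image fun p : Finset V × V => dir p.1 p.2).filter (· ≠ 0)) (by simp)
  let φ : (V → ℝ) →ₗ[ℝ] ℝ := ∑ v, w v • LinearMap.proj v
  have hφ : ∀ e, φ e = ∑ v, w v * e v := fun e => by simp [φ]
  have hφpos : ∀ l : V → ℝ, 0 ≤ l → φ l ≤ 0 → l = 0 := by
    intro l hl h0
    rw [hφ] at h0
    have h1 : ∀ v ∈ univ, 0 ≤ w v * l v := fun v _ => mul_nonneg (hw v).le (hl v)
    have h2 := (Finset.sum_eq_zero_iff_of_nonneg h1).1 (le_antisymm h0 (Finset.sum_nonneg h1))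
    funext v
    exact (mul_eq_zero.1 (h2 v (mem_univ v))).resolve_left (hw v).ne'
  have hexp : ∀ F, IsF F → ∀ e ∈ E, e = ∑ u ∈ F, e u • dir F u := by
    intro F hF e he
    obtain ⟨hl, hZ⟩ := hlF F hF
    have hmem : e - ∑ u ∈ F, e u • dir F u ∈ E :=
      E.sub_mem he (E.sum_mem fun u _ => E.smul_mem _ (hdir F u hF).1)
    refine sub_eq_zero.1 (hl.inj _ hmem fun v hv => ?_)
    have hvF : v ∈ F := hZ ▸ mem_zeroSet.2 hv
    have : ∀ u ∈ F, e u * dir F u v = if v = u then e u else 0 := fun u _ => by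
      rw [(hdir F u hF).2 v hvF]; simp
    simp [Finset.sum_apply, Finset.sum_congr rfl this, hvF]
  have hdne : ∀ F, IsF F → ∀ u ∈ F, φ (dir F u) ≠ 0 := by
    intro F hF u hu
    rw [hφ]
    refine hwd _ (mem_filter.2 ⟨mem_image.2 ⟨(F, u), mem_univ _, rfl⟩, fun h => ?_⟩)
    have := (hdir F u hF).2 u hu
    simp [h] at this
  let Rs : Finset V → Finset V := fun F => F.filter fun u => 0 < φ (dir F u)
  have hcmp : ∀ F, IsF F → ∀ L, Rs F ⊆ L → ∀ e ∈ E, (∀ v ∈ F, 0 ≤ e v) → (∀ v ∈ L, e v = 0) →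
      φ e ≤ 0 ∧ (φ e = 0 → ∀ v ∈ F, e v = 0) := by
    intro F hF L hR e he hnn hL
    have hsum : φ e = ∑ u ∈ F, e u * φ (dir F u) := by
      conv_lhs => rw [hexp F hF e he]
      simp [map_sum]
    have hterm : ∀ u ∈ F, e u * φ (dir F u) ≤ 0 := by
      intro u hu
      by_cases h : u ∈ Rs F
      · simp [hL u (hR h)]
      · exact mul_nonpos_of_nonneg_of_nonpos (hnn u hu) (by
          simpa [Rs, hu] using h)
    refine ⟨hsum ▸ Finset.sum_nonpos hterm, fun h0 v hv => ?_⟩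
    rw [hsum] at h0
    exact (mul_eq_zero.1 ((Finset.sum_eq_zero_iff_of_nonpos hterm).1 h0 v hv)).resolve_right
      (hdne F hF v hv)
  refine ⟨fun j => if IsF j.2 ∧ j.1 = Rs j.2 then 1 else 0, fun j hj => ?_, fun L => ?_⟩
  · have hj' : IsF j.2 ∧ j.1 = Rs j.2 := by
      by_contra h
      simp [h] at hj
    refine ⟨hj'.2 ▸ Finset.filter_subset _ _, ?_⟩
    obtain ⟨l, hl, hZ⟩ := hj'.1
    exact hZ ▸ hl.finrank_le
  · have hcount : (∑ j : Finset V × Finset V, if j.1 ⊆ L ∧ L ⊆ j.2 then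
        (if IsF j.2 ∧ j.1 = Rs j.2 then 1 else 0) else 0) =
        (univ.filter fun F => IsF F ∧ Rs F ⊆ L ∧ L ⊆ F).card := by
      rw [Fintype.sum_prod_type_right, Finset.card_filter]
      refine Finset.sum_congr rfl fun F _ => ?_
      rw [Finset.sum_eq_single (Rs F)]
      · by_cases h1 : IsF F <;> simp [h1]
      · intro R _ hR
        simp [hR]
      · simp
    rw [hcount]
    split_ifs with hP
    · obtain ⟨hnf, hex⟩ := hP
      rw [Finset.card_eq_one]
      obtain ⟨l₀, hl₀, hL₀⟩ := exists_isVertexOf hnf hex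
      obtain ⟨F, hF, hmax⟩ := Finset.exists_max_image (univ.filter fun F => IsF F ∧ L ⊆ F)
        (fun F => φ (lF F)) ⟨zeroSet l₀, by simpa using ⟨⟨l₀, hl₀, rfl⟩, hL₀⟩⟩
      simp only [mem_filter, mem_univ, true_and] at hF hmax
      obtain ⟨hF, hLF⟩ := hF
      obtain ⟨hl, hZ⟩ := hlF F hF
      have hz : ∀ v, lF F v = 0 ↔ v ∈ F := fun v => by
        conv_rhs => rw [← hZ]
        exact mem_zeroSet.symm
      have hRF : Rs F ⊆ L := by
        intro u hu
        by_contra huL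
        obtain ⟨huF, hupos⟩ := mem_filter.1 hu
        obtain ⟨hdE, hd⟩ := hdir F u hF
        have hneg : ∃ v, dir F u v < 0 := by
          by_contra! hcon
          have h0 := hnf _ hdE hcon fun v hv => by
            rw [hd v (hLF hv), if_neg]
            rintro rfl
            exact huL hv
          rw [h0] at hupos
          simp at hupos
        obtain ⟨s, hs, hs0, u', hu', hsu'⟩ := exists_move_to_boundary hl.nonneg hneg
          fun v hv => by
            rw [hd v ((hz v).1 hv)]
            split_ifs <;> norm_num
        have hzero : ∀ v ∈ F, v ≠ u → (lF F + s • dir F u) v = 0 := fun v hv hvu => by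
          simp [(hz v).2 hv, hd v hv, hvu]
        have hv' : IsVertexOf E a (lF F + s • dir F u) := by
          refine ⟨?_, hs0, fun e he hez => ?_⟩
          · rw [add_sub_right_comm]
            exact E.add_mem hl.sub_mem (E.smul_mem s hdE)
          · have h1 : e = e u • dir F u := by
              conv_lhs => rw [hexp F hF e he]
              refine Finset.sum_eq_single_of_mem u huF fun v hv hvu => ?_
              rw [hez v (hzero v hv hvu), zero_smul]
            have h2 : e u' = e u * dir F u u' := by
              conv_lhs => rw [h1]
              simp
            rw [hez u' (by simpa using hsu')] at h2
            rw [h1, (mul_eq_zero.1 h2.symm).resolve_right hu'.ne, zero_smul]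
        have hF' : IsF (zeroSet (lF F + s • dir F u)) := ⟨_, hv', rfl⟩
        have hle := hmax _ ⟨hF', fun v hv => mem_zeroSet.2 (hzero v (hLF hv) (by
          rintro rfl
          exact huL hv))⟩
        obtain ⟨hl2, hZ2⟩ := hlF _ hF'
        have heq : lF (zeroSet (lF F + s • dir F u)) = lF F + s • dir F u := by
          refine sub_eq_zero.1 (hl2.inj _ ?_ fun v hv => ?_)
          · have := E.sub_mem hl2.sub_mem hv'.sub_mem
            rwa [sub_sub_sub_cancel_right] at this
          · have : (lF F + s • dir F u) v = 0 :=
              mem_zeroSet.1 (hZ2 ▸ mem_zeroSet.2 hv)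
            rw [Pi.sub_apply, hv, this, sub_zero]
        rw [heq, map_add, map_smul, smul_eq_mul] at hle
        have := mul_pos hs hupos
        linarith
      refine ⟨F, Finset.eq_singleton_iff_unique_mem.2 ⟨by simpa using ⟨hF, hRF, hLF⟩, ?_⟩⟩
      intro G hG
      simp only [mem_filter, mem_univ, true_and] at hG
      obtain ⟨hG, hRG, hLG⟩ := hG
      obtain ⟨hlG, hZG⟩ := hlF G hG
      have hzG : ∀ v, lF G v = 0 ↔ v ∈ G := fun v => by
        conv_rhs => rw [← hZG]
        exact mem_zeroSet.symm
      have hGF := hcmp F hF L hRF (lF G - lF F)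
        (by simpa using E.sub_mem hlG.sub_mem hl.sub_mem)
        (fun v hv => by simpa [(hz v).2 hv] using hlG.nonneg v)
        (fun v hv => by simp [(hz v).2 (hLF hv), (hzG v).2 (hLG hv)])
      have hFG := hcmp G hG L hRG (lF F - lF G)
        (by simpa using E.sub_mem hl.sub_mem hlG.sub_mem)
        (fun v hv => by simpa [(hzG v).2 hv] using hl.nonneg v)
        (fun v hv => by simp [(hz v).2 (hLF hv), (hzG v).2 (hLG hv)])
      simp only [map_sub, Pi.sub_apply] at hGF hFG
      have heq : φ (lF G) = φ (lF F) := by linarith [hGF.1, hFG.1]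
      ext v
      constructor
      · intro hv
        have := hFG.2 (by linarith) v hv
        rw [(hzG v).2 hv, sub_zero] at this
        exact (hz v).1 this
      · intro hv
        have := hGF.2 (by linarith) v hv
        rw [(hz v).2 hv, sub_zero] at this
        exact (hzG v).1 this
    · rw [Finset.card_eq_zero, Finset.filter_eq_empty_iff]
      rintro F - ⟨hF, hRF, hLF⟩
      obtain ⟨hl, hZ⟩ := hlF F hF
      refine hP ⟨fun l hlE hl0 hlL => hφpos l hl0 ?_, lF F, hl.sub_mem, hl.nonneg, fun v hv => ?_⟩
      · exact (hcmp F hF L hRF l hlE (fun v _ => hl0 v) hlL).1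
      · exact mem_zeroSet.1 (by rw [hZ]; exact hLF hv)

theorem exists_intervalPartition_nonFace {V : Type*} [Fintype V] (E : Submodule ℝ (V → ℝ)) :
    ∃ w, IntervalPartition (Module.finrank ℝ E) (NonFace E) w := by
  classical
  induction E using WellFoundedGT.induction with
  | ind E ih =>
    by_cases hE : E = ⊤
    · subst hE
      refine ⟨fun j => if j = (univ, univ) then 1 else 0, fun j hj => ?_, fun L => ?_⟩
      · have : j = (univ, univ) := by
          by_contra h
          simp [h] at hj
        subst this
        simp
      · rw [Finset.sum_eq_single (univ, univ)]
        · have : NonFace (⊤ : Submodule ℝ (V → ℝ)) L ↔ univ ⊆ L := by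
            constructor
            · intro h v _
              by_contra hv
              have := congrFun (h (Pi.single v 1) trivial (by
                intro u; by_cases hu : u = v
                · subst hu; simp
                · simp [hu]) fun u hu => by
                rw [Pi.single_eq_of_ne]; rintro rfl; exact hv hu) v
              simp at this
            · intro h l _ _ hl
              funext v
              exact hl v (h (mem_univ v))
          simp [this]
        · intro j _ hj
          simp [hj]
        · simp
    · obtain ⟨a, ha⟩ := exists_generic E
      have haE : a ∉ E := fun h => hE (by
        rw [eq_top_iff]
        intro b _
        obtain ⟨e, he, h'⟩ := ha univ ⟨a, h, fun _ _ => rfl⟩ b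
        have : e = b := funext fun v => h' v (mem_univ v)
        exact this ▸ he)
      have hlt : E < E ⊔ Submodule.span ℝ {a} := by
        refine lt_of_le_of_ne le_sup_left fun h => haE ?_
        rw [h]
        exact Submodule.mem_sup_right (Submodule.mem_span_singleton_self a)
      obtain ⟨w₀, h₀, h₀'⟩ := ih _ hlt
      obtain ⟨w₁, h₁, h₁'⟩ := exists_intervalPartition_interior E a ha
      obtain ⟨w₂, h₂, h₂'⟩ := exists_intervalPartition_interior E (-a) (by
        rintro S ⟨e, he, h⟩
        exact ha S ⟨-e, E.neg_mem he, fun v hv => by simp [h v hv]⟩)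
      refine ⟨w₀ + w₁ + w₂, fun j hj => ?_, fun L => ?_⟩
      · rcases Nat.eq_zero_or_pos (w₀ j) with h | h
        · rcases Nat.eq_zero_or_pos (w₁ j) with h' | h'
          · exact h₂ j (by simpa [h, h'] using hj)
          · exact h₁ j h'.ne'
        · obtain ⟨hs, hc⟩ := h₀ j h.ne'
          exact ⟨hs, (Submodule.finrank_mono hlt.le).trans hc⟩
      · have hsplit : (∑ j : Finset V × Finset V,
            if j.1 ⊆ L ∧ L ⊆ j.2 then (w₀ + w₁ + w₂) j else 0) =
            (∑ j : Finset V × Finset V, if j.1 ⊆ L ∧ L ⊆ j.2 then w₀ j else 0) +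
            (∑ j : Finset V × Finset V, if j.1 ⊆ L ∧ L ⊆ j.2 then w₁ j else 0) +
            (∑ j : Finset V × Finset V, if j.1 ⊆ L ∧ L ⊆ j.2 then w₂ j else 0) := by
          rw [← Finset.sum_add_distrib, ← Finset.sum_add_distrib]
          refine Finset.sum_congr rfl fun j _ => ?_
          split_ifs <;> simp
        rw [hsplit, h₀', h₁', h₂']
        by_cases hL : NonFace E L
        · have hboth : ¬ ((∃ l, l - a ∈ E ∧ 0 ≤ l ∧ ∀ v ∈ L, l v = 0) ∧
              (∃ l, l - -a ∈ E ∧ 0 ≤ l ∧ ∀ v ∈ L, l v = 0)) := by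
            rintro ⟨⟨l, h1, h2, h3⟩, l', h1', h2', h3'⟩
            have hsum : l + l' = 0 := hL _ (by
              have := E.add_mem h1 h1'
              rwa [show l - a + (l' - -a) = l + l' by abel] at this) (add_nonneg h2 h2')
              fun v hv => by simp [h3 v hv, h3' v hv]
            have hl0 : l = 0 := le_antisymm (by
              rw [← hsum]; exact le_add_of_nonneg_right h2') h2
            rw [hl0, zero_sub] at h1
            exact haE (by simpa using E.neg_mem h1)
          have hiff : NonFace (E ⊔ Submodule.span ℝ {a}) L ↔
              ¬ (∃ l, l - a ∈ E ∧ 0 ≤ l ∧ ∀ v ∈ L, l v = 0) ∧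
              ¬ (∃ l, l - -a ∈ E ∧ 0 ≤ l ∧ ∀ v ∈ L, l v = 0) := by
            have haS : a ∈ E ⊔ Submodule.span ℝ {a} :=
              Submodule.mem_sup_right (Submodule.mem_span_singleton_self a)
            constructor
            · intro h
              constructor
              · rintro ⟨l, h1, h2, h3⟩
                have h0 := h l (by
                  have := Submodule.add_mem _ (hlt.le h1) haS
                  simpa using this) h2 h3
                rw [h0, zero_sub] at h1
                exact haE (by simpa using E.neg_mem h1)
              · rintro ⟨l, h1, h2, h3⟩
                have h0 := h l (by
                  have := Submodule.sub_mem _ (hlt.le h1) haS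
                  simpa using this) h2 h3
                rw [h0] at h1
                exact haE (by simpa using h1)
            · rintro ⟨hn1, hn2⟩ l hl hl0 hlL
              obtain ⟨e, he, x, hx, rfl⟩ := Submodule.mem_sup.1 hl
              obtain ⟨c, rfl⟩ := Submodule.mem_span_singleton.1 hx
              rcases lt_trichotomy c 0 with hc | rfl | hc
              · refine absurd ⟨(-c)⁻¹ • (e + c • a), ?_, ?_, fun v hv => ?_⟩ hn2
                · have : (-c)⁻¹ • (e + c • a) - -a = (-c)⁻¹ • e := by
                    rw [smul_add, smul_smul, inv_neg, neg_mul, inv_mul_cancel₀ hc.ne]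
                    simp
                  rw [this]
                  exact E.smul_mem _ he
                · exact smul_nonneg (inv_nonneg.2 (neg_nonneg.2 hc.le)) hl0
                · rw [Pi.smul_apply, hlL v hv, smul_zero]
              · exact hL _ (by simpa using he) hl0 hlL
              · refine absurd ⟨c⁻¹ • (e + c • a), ?_, ?_, fun v hv => ?_⟩ hn1
                · have : c⁻¹ • (e + c • a) - a = c⁻¹ • e := by
                    rw [smul_add, smul_smul, inv_mul_cancel₀ hc.ne']
                    simp
                  rw [this]
                  exact E.smul_mem _ he
                · exact smul_nonneg (inv_nonneg.2 hc.le) hl0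
                · rw [Pi.smul_apply, hlL v hv, smul_zero]
          simp only [hL, hiff, true_and, if_true]
          by_cases h1 : ∃ l, l - a ∈ E ∧ 0 ≤ l ∧ ∀ v ∈ L, l v = 0
          · have h2 : ¬ ∃ l, l - -a ∈ E ∧ 0 ≤ l ∧ ∀ v ∈ L, l v = 0 := fun h => hboth ⟨h1, h⟩
            simp only [h1, h2]
            simp
          · by_cases h2 : ∃ l, l - -a ∈ E ∧ 0 ≤ l ∧ ∀ v ∈ L, l v = 0
            · simp only [h1, h2]
              simp
            · simp only [h1, h2]
              simp
        · have h' : ¬ NonFace (E ⊔ Submodule.span ℝ {a}) L :=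
            fun h => hL fun l hl => h l (hlt.le hl)
          simp [hL, h']

/-- The `k`-th entry of the `h`-vector of a family with `N i` members of cardinality `i`, when the
maximal cardinality is `D`. -/
def hSum (D k : ℕ) (N : ℕ → ℤ) : ℤ :=
  ∑ i ∈ range (D + 1), (-1 : ℤ) ^ ((k : ℤ) - i).natAbs * ch ((D : ℤ) - i) ((D : ℤ) - k) * N i

theorem ch_natCast (a b : ℕ) : ch a b = a.choose b := by
  simp [ch, Ring.choose_natCast]

theorem neg_one_pow_mul_ch {D k i : ℕ} (hk : k ≤ D) (hi : i ≤ k) :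
    (-1 : ℤ) ^ ((k : ℤ) - i).natAbs * ch ((D : ℤ) - i) ((D : ℤ) - k) =
      Ring.choose ((k : ℤ) - D - 1) (k - i) := by
  obtain ⟨a, rfl⟩ := Nat.exists_eq_add_of_le hi
  obtain ⟨b, rfl⟩ := Nat.exists_eq_add_of_le hk
  have h1 : ((i + a : ℕ) : ℤ) - i = a := by push_cast; ring
  have h2 : ((i + a + b : ℕ) : ℤ) - i = (a + b : ℕ) := by push_cast; ring
  have h3 : ((i + a + b : ℕ) : ℤ) - (i + a : ℕ) = b := by push_cast; ring
  have h4 : ((i + a : ℕ) : ℤ) - (i + a + b : ℕ) - 1 = -((b : ℤ) + 1) := by push_cast; ring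
  rw [h1, h2, h3, h4, ch_natCast, Ring.choose_neg,
    show (b : ℤ) + 1 + ((i + a - i : ℕ) : ℤ) - 1 = (a + b : ℕ) by
      rw [Nat.add_sub_cancel_left]; push_cast; ring, Ring.choose_natCast,
    Nat.add_sub_cancel_left, Nat.choose_symm_add, Units.smul_def, smul_eq_mul]
  simp [Int.negOnePow_def]

theorem ch_sub_eq_zero {D k i : ℕ} (hk : k < i) (hi : i ≤ D) :
    ch ((D : ℤ) - i) ((D : ℤ) - k) = 0 := by
  rw [← Nat.cast_sub hi, ← Nat.cast_sub (hk.le.trans hi), ch_natCast,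
    Nat.choose_eq_zero_of_lt (by omega), Nat.cast_zero]

theorem hSum_eq_sum_range {D k : ℕ} (hk : k ≤ D) (N : ℕ → ℤ) :
    hSum D k N = ∑ i ∈ range (k + 1), Ring.choose ((k : ℤ) - D - 1) (k - i) * N i := by
  unfold hSum
  rw [← Finset.sum_subset (range_subset_range.2 (Nat.succ_le_succ hk))]
  · refine Finset.sum_congr rfl fun i hi => ?_
    rw [neg_one_pow_mul_ch hk (Nat.lt_succ_iff.1 (mem_range.1 hi))]
  · intro i hi hik
    rw [mem_range] at hi hik
    rw [ch_sub_eq_zero (by omega) (by omega)]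
    simp

theorem hSum_choose {D k : ℕ} (hk : k ≤ D) (n : ℕ) :
    hSum D k (fun i => n.choose i) = Ring.choose ((n : ℤ) - D - 1 + k) k := by
  rw [hSum_eq_sum_range hk, show (n : ℤ) - D - 1 + k = n + (k - D - 1) by ring,
    Ring.add_choose_eq k (Commute.all _ _),
    Finset.Nat.sum_antidiagonal_eq_sum_range_succ
      (fun i j => Ring.choose (n : ℤ) i * Ring.choose ((k : ℤ) - D - 1) j)]
  refine Finset.sum_congr rfl fun i _ => ?_
  rw [Ring.choose_natCast, mul_comm]

theorem hSum_interval {D k r n : ℕ} (hk : k ≤ D) :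
    hSum D k (fun i => if r ≤ i then (n.choose (i - r) : ℤ) else 0) =
      if r ≤ k then Ring.choose ((n + r : ℤ) - D - 1 + (k - r : ℕ)) (k - r) else 0 := by
  split_ifs with hr
  · obtain ⟨a, rfl⟩ := Nat.exists_eq_add_of_le hr
    obtain ⟨b, rfl⟩ := Nat.exists_eq_add_of_le hk
    have h := hSum_choose (D := a + b) (k := a) (by omega) n
    rw [hSum_eq_sum_range (by omega)] at h
    rw [hSum_eq_sum_range hk, show r + a + 1 = r + (a + 1) by ring, Finset.sum_range_add,
      Finset.sum_eq_zero, zero_add]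
    · rw [Nat.add_sub_cancel_left, show (n + r : ℤ) - (r + a + b : ℕ) - 1 + (a : ℕ) =
        n - (a + b : ℕ) - 1 + a by push_cast; ring, ← h]
      refine Finset.sum_congr rfl fun i _ => ?_
      rw [if_pos (Nat.le_add_right r i), Nat.add_sub_cancel_left, Nat.add_sub_add_left,
        show ((r + a : ℕ) : ℤ) - (r + a + b : ℕ) - 1 = a - (a + b : ℕ) - 1 by push_cast; ring]
    · intro i hi
      rw [if_neg (not_le.2 (mem_range.1 hi)), mul_zero]
  · rw [hSum_eq_sum_range hk]
    refine Finset.sum_eq_zero fun i hi => ?_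
    rw [if_neg (by rw [mem_range] at hi; omega), mul_zero]

theorem hSum_interval_pos {D k r n : ℕ} (hk : k ≤ D) (hr : r ≤ k) (hn : D + 1 ≤ n + r) :
    0 < hSum D k (fun i => if r ≤ i then (n.choose (i - r) : ℤ) else 0) := by
  rw [hSum_interval hk, if_pos hr,
    show (n + r : ℤ) - D - 1 + (k - r : ℕ) = (n + r - (D + 1) + (k - r) : ℕ) by
      push_cast [hn]; ring, Ring.choose_natCast]
  exact_mod_cast Nat.choose_pos (by omega)

theorem hSum_sub (D k : ℕ) (N M : ℕ → ℤ) :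
    hSum D k (fun i => N i - M i) = hSum D k N - hSum D k M := by
  simp [hSum, mul_sub]

theorem hSum_sum {ι : Type*} (s : Finset ι) (D k : ℕ) (c : ι → ℤ) (N : ι → ℕ → ℤ) :
    hSum D k (fun i => ∑ j ∈ s, c j * N j i) = ∑ j ∈ s, c j * hSum D k (N j) := by
  simp only [hSum, Finset.mul_sum]
  rw [Finset.sum_comm]
  exact Finset.sum_congr rfl fun j _ => Finset.sum_congr rfl fun i _ => by ring

theorem hSum_congr {D k : ℕ} {N M : ℕ → ℤ} (h : ∀ i ≤ D, N i = M i) :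
    hSum D k N = hSum D k M :=
  Finset.sum_congr rfl fun i hi => by rw [h i (Nat.lt_succ_iff.1 (mem_range.1 hi))]

theorem card_filter_interval {V : Type*} [Fintype V] [DecidableEq V] {R F : Finset V}
    (h : R ⊆ F) (l : ℕ) :
    (univ.filter fun L : Finset V => (R ⊆ L ∧ L ⊆ F) ∧ L.card = l).card =
      if R.card ≤ l then (F.card - R.card).choose (l - R.card) else 0 := by
  split_ifs with hl
  · rw [← Finset.card_sdiff_of_subset h, ← Finset.card_powersetCard]
    refine Finset.card_nbij' (· \ R) (· ∪ R) ?_ ?_ ?_ ?_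
    · intro L hL
      simp only [coe_filter, mem_univ, true_and, Set.mem_ofPred_eq] at hL
      simp only [mem_coe, mem_powersetCard]
      exact ⟨Finset.sdiff_subset_sdiff hL.1.2 le_rfl, by
        rw [Finset.card_sdiff_of_subset hL.1.1, hL.2]⟩
    · intro L hL
      simp only [mem_coe, mem_powersetCard] at hL
      have hd : Disjoint L R := Finset.disjoint_of_subset_left hL.1 sdiff_disjoint
      simp only [coe_filter, mem_univ, true_and, Set.mem_ofPred_eq]
      exact ⟨⟨subset_union_right, union_subset (hL.1.trans sdiff_subset) h⟩, by
        rw [Finset.card_union_of_disjoint hd, hL.2]; omega⟩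
    · intro L hL
      simp only [coe_filter, mem_univ, true_and, Set.mem_ofPred_eq] at hL
      exact Finset.sdiff_union_of_subset hL.1.1
    · intro L hL
      simp only [mem_coe, mem_powersetCard] at hL
      have hd : Disjoint L R := Finset.disjoint_of_subset_left hL.1 sdiff_disjoint
      exact Finset.union_sdiff_cancel_right hd
  · rw [Finset.card_eq_zero, Finset.filter_eq_empty_iff]
    rintro L - ⟨h1, rfl⟩
    exact hl (Finset.card_le_card h1.1)

open scoped Classical in
theorem IntervalPartition.card_eq {V : Type*} [Fintype V] {m : ℕ} {P : Finset V → Prop}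
    {w : Finset V × Finset V → ℕ} (h : IntervalPartition m P w) (l : ℕ) :
    ((univ.filter fun L : Finset V => L.card = l ∧ P L).card : ℤ) =
      ∑ j, (w j : ℤ) * if j.1.card ≤ l then
        ((j.2.card - j.1.card).choose (l - j.1.card) : ℤ) else 0 := by
  have h1 : (univ.filter fun L : Finset V => L.card = l ∧ P L).card =
      ∑ L ∈ univ.filter (fun L : Finset V => L.card = l), if P L then 1 else 0 := by
    rw [← Finset.card_filter, Finset.filter_filter]
  rw [h1, Finset.sum_congr rfl fun L _ => (h.2 L).symm, Finset.sum_comm]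
  push_cast
  refine Finset.sum_congr rfl fun j _ => ?_
  by_cases hj : w j = 0
  · simp [hj]
  · have h2 := card_filter_interval (h.1 j hj).1 l
    rw [← Finset.sum_filter, Finset.filter_filter, Finset.sum_const, nsmul_eq_mul, mul_comm]
    congr 1
    simp only [and_comm (a := Finset.card _ = l), h2]
    split_ifs <;> simp

open scoped Classical in
theorem IntervalPartition.hSum_nonneg {V : Type*} [Fintype V] {D k : ℕ} {P : Finset V → Prop}
    {w : Finset V × Finset V → ℕ} (h : IntervalPartition (D + 1) P w) (hk : k ≤ D) :
    0 ≤ hSum D k (fun l => ((univ.filter fun L : Finset V => L.card = l ∧ P L).card : ℤ)) ∧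
    (hSum D k (fun l => ((univ.filter fun L : Finset V => L.card = l ∧ P L).card : ℤ)) = 0 ↔
      ∀ l ≤ k, (univ.filter fun L : Finset V => L.card = l ∧ P L).card = 0) := by
  have hterm : ∀ j ∈ univ, 0 ≤ (w j : ℤ) * hSum D k (fun i => if j.1.card ≤ i then
      ((j.2.card - j.1.card).choose (i - j.1.card) : ℤ) else 0) := by
    intro j _
    by_cases hj : w j = 0
    · simp [hj]
    · by_cases hjk : j.1.card ≤ k
      · obtain ⟨h1, h2⟩ := h.1 j hj
        have := Finset.card_le_card h1
        exact mul_nonneg (Nat.cast_nonneg _) (hSum_interval_pos hk hjk (by omega)).le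
      · rw [hSum_interval hk, if_neg hjk, mul_zero]
  simp only [h.card_eq, hSum_sum]
  refine ⟨Finset.sum_nonneg hterm, ?_⟩
  rw [Finset.sum_eq_zero_iff_of_nonneg hterm]
  constructor
  · intro h0 l hl
    have hz : ∀ j, w j ≠ 0 → k < j.1.card := by
      intro j hj
      by_contra! hjk
      obtain ⟨h1, h2⟩ := h.1 j hj
      have := Finset.card_le_card h1
      exact (mul_pos (Int.natCast_pos.2 (Nat.pos_of_ne_zero hj))
        (hSum_interval_pos hk hjk (by omega))).ne' (h0 j (mem_univ j))
    rw [← Int.natCast_eq_zero, h.card_eq]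
    refine Finset.sum_eq_zero fun j _ => ?_
    by_cases hj : w j = 0
    · simp [hj]
    · rw [if_neg (by have := hz j hj; omega), mul_zero]
  · intro h0 j _
    by_cases hj : w j = 0
    · simp [hj]
    · by_cases hjk : j.1.card ≤ k
      · have h1 := h.2 j.1
        have h2 := Finset.card_eq_zero.1 (h0 _ hjk)
        have h3 : ¬ P j.1 := fun hP =>
          Finset.notMem_empty j.1 (h2 ▸ mem_filter.2 ⟨mem_univ _, rfl, hP⟩)
        rw [if_neg h3, Finset.sum_eq_zero_iff] at h1
        have := h1 j (mem_univ j)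
        rw [if_pos ⟨le_rfl, (h.1 j hj).1⟩] at this
        exact absurd this hj
      · rw [hSum_interval hk, if_neg hjk, mul_zero]

section Convexity

variable {E : Type*} [AddCommGroup E] [Module ℝ E]

theorem nonneg_and_mem_convexHull_of_eq_zero {A : Set E} {f : E →ᵃ[ℝ] ℝ}
    (hf : ∀ a ∈ A, 0 ≤ f a) {x : E} (hx : x ∈ convexHull ℝ A) :
    0 ≤ f x ∧ (f x = 0 → x ∈ convexHull ℝ {a ∈ A | f a = 0}) := by
  let S : Set E := {x | 0 ≤ f x ∧ (f x = 0 → x ∈ convexHull ℝ {a ∈ A | f a = 0})}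
  have hS : Convex ℝ S := by
    rintro x ⟨hx, hx'⟩ y ⟨hy, hy'⟩ a b ha hb hab
    have h1 := mul_nonneg ha hx
    have h2 := mul_nonneg hb hy
    have h3 := Convex.combo_affine_apply (f := f) (x := x) (y := y) hab
    simp only [smul_eq_mul] at h3
    refine ⟨by rw [h3]; exact add_nonneg h1 h2, fun h0 => ?_⟩
    rw [h3, add_eq_zero_iff_of_nonneg h1 h2, mul_eq_zero, mul_eq_zero] at h0
    rcases h0 with ⟨rfl | h4, rfl | h5⟩
    · norm_num at hab
    · rw [zero_add] at hab
      simpa [hab] using hy' h5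
    · rw [add_zero] at hab
      simpa [hab] using hx' h4
    · exact convex_convexHull ℝ _ (hx' h4) (hy' h5) ha hb hab
  have hAS : A ⊆ S := fun a ha => ⟨hf a ha, fun h0 => subset_convexHull ℝ _ ⟨ha, h0⟩⟩
  exact convexHull_min hAS hS hx

theorem mem_extremePoints_convexHull {A : Set E} {x : E} (hx : x ∈ A)
    (hxA : x ∉ convexHull ℝ (A \ {x})) : x ∈ (convexHull ℝ A).extremePoints ℝ := by
  have key : ∀ y ∈ convexHull ℝ A, ∃ c : ℝ, ∃ z, 0 ≤ c ∧ y - x = c • (z - x) ∧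
      (c ≠ 0 → z ∈ convexHull ℝ (A \ {x})) := by
    intro y hy
    rcases (A \ {x}).eq_empty_or_nonempty with h | h
    · have hA : A = {x} := (Set.sdiff_eq_empty.1 h).antisymm (by simpa using hx)
      rw [hA, convexHull_singleton, Set.mem_singleton_iff] at hy
      exact ⟨0, x, le_rfl, by simp [hy], fun h => absurd rfl h⟩
    · rw [← Set.insert_eq_of_mem hx, ← Set.insert_sdiff_singleton, convexHull_insert h,
        mem_convexJoin] at hy
      obtain ⟨_, rfl, z, hz, hy⟩ := hy
      rw [segment_eq_image] at hy
      obtain ⟨c, hc, rfl⟩ := hy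
      exact ⟨c, z, hc.1, by module, fun _ => hz⟩
  rw [mem_extremePoints]
  refine ⟨subset_convexHull ℝ A hx, fun u hu v hv => ?_⟩
  rintro ⟨a, b, ha, hb, hab, hx'⟩
  obtain ⟨c, z, hc, hcz, hz⟩ := key u hu
  obtain ⟨c', z', hc', hcz', hz'⟩ := key v hv
  have hsum : (a * c) • (z - x) + (b * c') • (z' - x) = 0 := by
    rw [mul_smul, mul_smul, ← hcz, ← hcz']
    calc a • (u - x) + b • (v - x) = (a • u + b • v) - (a + b) • x := by module
      _ = 0 := by rw [hx', hab, one_smul, sub_self]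
  have hc0 : c = 0 ∧ c' = 0 := by
    by_contra hne
    have hpos : 0 < a * c + b * c' := by
      rcases hc.eq_or_lt with rfl | h
      · have : 0 < c' := lt_of_le_of_ne hc' fun h => hne ⟨rfl, h.symm⟩
        positivity
      · positivity
    apply hxA
    have hx2 : x = (a * c / (a * c + b * c')) • z + (b * c' / (a * c + b * c')) • z' := by
      have : (a * c + b * c') • x = (a * c) • z + (b * c') • z' := by
        rw [← sub_eq_zero, ← neg_eq_zero, ← hsum]
        module
      refine smul_right_injective E hpos.ne' ?_
      simp only [this, smul_add, smul_smul, mul_div_cancel₀ _ hpos.ne']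
    by_cases h1 : c = 0
    · have h2 : c' ≠ 0 := fun h => hne ⟨h1, h⟩
      rw [h1, mul_zero, zero_add, zero_div, zero_smul, zero_add,
        div_self (mul_pos hb (lt_of_le_of_ne hc' h2.symm)).ne', one_smul] at hx2
      exact hx2 ▸ hz' h2
    · by_cases h2 : c' = 0
      · rw [h2, mul_zero, add_zero, zero_div, zero_smul, add_zero,
          div_self (mul_pos ha (lt_of_le_of_ne hc (Ne.symm h1))).ne', one_smul] at hx2
        exact hx2 ▸ hz h1
      · refine Set.mem_of_eq_of_mem hx2 (convex_convexHull ℝ _ (hz h1) (hz' h2) ?_ ?_ ?_)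
        · positivity
        · positivity
        · rw [← add_div, div_self hpos.ne']
  rw [hc0.1, zero_smul, sub_eq_zero] at hcz
  rw [hc0.2, zero_smul, sub_eq_zero] at hcz'
  exact ⟨hcz, hcz'⟩

end Convexity

section Configuration

variable {I E : Type*} [AddCommGroup E] [Module ℝ E]

/-- The space of restrictions of affine functions to a point configuration. -/
def affineValues (p : I → E) : Submodule ℝ (I → ℝ) :=
  LinearMap.range
    ({ toFun := fun f i => f (p i)
       map_add' := fun _ _ => rfl
       map_smul' := fun _ _ => rfl } : (E →ᵃ[ℝ] ℝ) →ₗ[ℝ] (I → ℝ))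

theorem finrank_affineValues [Module.Finite ℝ E] {p : I → E}
    (hp : ∀ f : E →ᵃ[ℝ] ℝ, (∀ i, f (p i) = 0) → f = 0) :
    Module.finrank ℝ (affineValues p) = Module.finrank ℝ E + 1 := by
  unfold affineValues
  rw [LinearMap.finrank_range_of_inj, AffineMap.finrank_eq, Module.finrank_self, mul_one]
  rw [← LinearMap.ker_eq_bot, LinearMap.ker_eq_bot']
  exact fun f hf => hp f fun i => congrFun hf i

/-- The points are pairwise distinct and in convex position. -/
def ConvexPosition (p : I → E) : Prop :=
  ∀ i, p i ∉ convexHull ℝ (p '' {i}ᶜ)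

theorem ConvexPosition.mem_convexHull_iff {p : I → E} (hp : ConvexPosition p) {S : Set I}
    {i : I} : p i ∈ convexHull ℝ (p '' S) ↔ i ∈ S := by
  refine ⟨fun h => ?_, fun h => subset_convexHull ℝ _ ⟨i, h, rfl⟩⟩
  by_contra hi
  refine hp i (convexHull_mono (Set.image_mono fun j hj => ?_) h)
  rintro rfl
  exact hi hj

theorem ConvexPosition.injective {p : I → E} (hp : ConvexPosition p) : Function.Injective p :=
  fun i j h => by
    have : p i ∈ convexHull ℝ (p '' {j}) := by simp [h]
    simpa using hp.mem_convexHull_iff.1 this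

theorem ConvexPosition.affineIndependent {p : I → E} (hp : ConvexPosition p) {S : Set I}
    {A : Set E} (hA : AffineIndependent ℝ (fun v : A => (v : E)))
    (h : convexHull ℝ (p '' S) = convexHull ℝ A) :
    AffineIndependent ℝ (fun v : p '' S => (v : E)) := by
  refine hA.mono ?_
  rintro _ ⟨i, hi, rfl⟩
  refine extremePoints_convexHull_subset (𝕜 := ℝ) (h ▸ mem_extremePoints_convexHull ⟨i, hi, rfl⟩ ?_)
  refine fun hmem => hp i (convexHull_mono ?_ hmem)
  rintro _ ⟨⟨j, -, rfl⟩, hj⟩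
  refine ⟨j, ?_, rfl⟩
  rintro rfl
  exact hj rfl

theorem convexHull_image_zeroSet [Fintype I] {p : I → E} {f : E →ᵃ[ℝ] ℝ}
    (hf : ∀ i, 0 ≤ f (p i)) :
    convexHull ℝ (p '' (zeroSet fun i => f (p i))) =
      {x ∈ convexHull ℝ (Set.range p) | f x = 0} := by
  apply Set.Subset.antisymm
  · intro x hx
    refine ⟨convexHull_mono (Set.image_subset_range _ _) hx, ?_⟩
    refine convexHull_min (t := {x | f x = 0}) ?_ ?_ hx
    · rintro _ ⟨i, hi, rfl⟩
      exact (mem_zeroSet (l := fun i => f (p i))).1 hi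
    · exact (convex_singleton (0 : ℝ)).affine_preimage f
  · rintro x ⟨hx, h0⟩
    refine convexHull_mono ?_ ((nonneg_and_mem_convexHull_of_eq_zero
      (by rintro _ ⟨i, rfl⟩; exact hf i) hx).2 h0)
    rintro _ ⟨⟨i, rfl⟩, hi⟩
    exact ⟨i, mem_zeroSet.2 hi, rfl⟩

/-- If the zero set of a nonnegative affine function is affinely independent, each of its subsets
is the zero set of a nonnegative affine function. -/
theorem exists_zeroSet_eq_of_subset [Fintype I] {p : I → E} (hp : Function.Injective p)
    {f : E →ᵃ[ℝ] ℝ} (hf : ∀ i, 0 ≤ f (p i)) {L : Finset I}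
    (hL : L ⊆ zeroSet fun i => f (p i))
    (hind : AffineIndependent ℝ
      (fun v : p '' (zeroSet fun i => f (p i)) => (v : E))) :
    ∃ g : E →ᵃ[ℝ] ℝ, (∀ i, 0 ≤ g (p i)) ∧ (zeroSet fun i => g (p i)) = L := by
  classical
  obtain ⟨t, hZt, ht, htop⟩ := exists_subset_affineIndependent_affineSpan_eq_top hind
  let b : AffineBasis t ℝ E := ⟨fun x => x, ht, by simpa using htop⟩
  have hmem : ∀ i ∈ zeroSet fun i => f (p i), p i ∈ t := fun i hi => hZt ⟨i, hi, rfl⟩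
  let q : I → t := fun i => if h : p i ∈ t then ⟨p i, h⟩ else b.nonempty.some
  have hq : ∀ i ∈ zeroSet fun i => f (p i), b (q i) = p i := fun i hi => by
    simp only [q, hmem i hi, dite_true]
    rfl
  let e : E →ᵃ[ℝ] ℝ := ∑ i ∈ (zeroSet fun i => f (p i)) \ L, b.coord (q i)
  have heval : ∀ x, e x = ∑ i ∈ (zeroSet fun i => f (p i)) \ L, b.coord (q i) x := fun x => by
    simp only [e]
    induction (zeroSet fun i => f (p i)) \ L using Finset.induction_on with
    | empty => simp
    | insert a s ha ih => rw [Finset.sum_insert ha, Finset.sum_insert ha, ← ih]; rfl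
  have he : ∀ j ∈ zeroSet fun i => f (p i), e (p j) = if j ∈ L then 0 else 1 := by
    intro j hj
    have hterm : ∀ i ∈ (zeroSet fun i => f (p i)) \ L,
        b.coord (q i) (p j) = if i = j then 1 else 0 := fun i hi => by
      rw [← hq j hj, AffineBasis.coord_apply]
      have : q i = q j ↔ i = j := by
        refine ⟨fun h => hp ?_, fun h => by rw [h]⟩
        rw [← hq i (mem_sdiff.1 hi).1, ← hq j hj, h]
      simp [this]
    rw [heval, Finset.sum_congr rfl hterm, Finset.sum_ite_eq']
    by_cases hjL : j ∈ L <;> simp [hj, hjL]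
  let K : ℝ := ∑ i, (1 + |e (p i)|) / f (p i)
  have hK : ∀ i ∉ zeroSet fun i => f (p i), 1 ≤ (e + K • f) (p i) := by
    intro i hi
    rw [mem_zeroSet] at hi
    have hpos : 0 < f (p i) := lt_of_le_of_ne (hf i) (Ne.symm hi)
    have h1 : (1 + |e (p i)|) / f (p i) ≤ K :=
      Finset.single_le_sum (f := fun i => (1 + |e (p i)|) / f (p i))
        (fun j _ => div_nonneg (by positivity) (hf j)) (mem_univ i)
    rw [div_le_iff₀ hpos] at h1
    have h2 := neg_abs_le (e (p i))
    have h3 : (e + K • f) (p i) = e (p i) + K * f (p i) := rfl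
    linarith
  have hZ : ∀ i ∈ zeroSet fun i => f (p i), (e + K • f) (p i) = if i ∈ L then 0 else 1 := by
    intro i hi
    have h3 : (e + K • f) (p i) = e (p i) + K * f (p i) := rfl
    rw [h3, he i hi, mem_zeroSet.1 hi, mul_zero, add_zero]
  refine ⟨e + K • f, fun i => ?_, ?_⟩
  · by_cases hi : i ∈ zeroSet fun i => f (p i)
    · rw [hZ i hi]
      split_ifs <;> norm_num
    · exact zero_le_one.trans (hK i hi)
  · ext i
    rw [mem_zeroSet]
    by_cases hi : i ∈ zeroSet fun i => f (p i)
    · rw [hZ i hi]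
      simp
    · have h1 := hK i hi
      exact ⟨fun h => by linarith, fun h => absurd (hL h) hi⟩

end Configuration

section Faces

variable {I : Type*} {D : ℕ}

theorem sdim_convexHull_image {p : I → Vec D} (hp : Function.Injective p) {L : Finset I}
    (hind : AffineIndependent ℝ (fun v : p '' L => (v : Vec D))) :
    sdim (convexHull ℝ (p '' L)) = (L.card : ℤ) - 1 := by
  classical
  rcases L.eq_empty_or_nonempty with rfl | hL
  · simp [sdim]
  · have hne : convexHull ℝ (p '' (L : Set I)) ≠ ∅ := by
      rw [← Set.nonempty_iff_ne_empty, convexHull_nonempty_iff]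
      exact Set.image_nonempty.2 hL
    obtain ⟨n, hn⟩ := Nat.exists_eq_succ_of_ne_zero hL.card_pos.ne'
    have hcard : Fintype.card (p '' (L : Set I)) = n + 1 := by
      rw [Fintype.card_eq_nat_card, Nat.card_image_of_injective hp]
      simp [hn]
    have := hind.finrank_vectorSpan hcard
    rw [Subtype.range_coe] at this
    rw [sdim, if_neg hne, affineSpan_convexHull, direction_affineSpan, this, hn]
    push_cast
    ring

variable [Fintype I]

theorem isExposed_convexHull_zeroSet {p : I → Vec D} {f : Vec D →ᵃ[ℝ] ℝ}
    (hf : ∀ i, 0 ≤ f (p i)) :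
    IsExposed ℝ (convexHull ℝ (Set.range p))
      (convexHull ℝ (p '' (zeroSet fun i => f (p i)))) := by
  rintro ⟨x₀, hx₀⟩
  rw [convexHull_image_zeroSet hf] at hx₀ ⊢
  refine ⟨LinearMap.toContinuousLinearMap (-f.linear), ?_⟩
  have hlin : ∀ x y, f.linear y - f.linear x = f y - f x := fun x y => by
    rw [← map_sub]
    simpa using f.linearMap_vsub y x
  ext x
  refine and_congr_right fun hx => ?_
  have hnn : ∀ y ∈ convexHull ℝ (Set.range p), 0 ≤ f y := fun y hy =>
    (nonneg_and_mem_convexHull_of_eq_zero (by rintro _ ⟨i, rfl⟩; exact hf i) hy).1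
  simp only [LinearMap.coe_toContinuousLinearMap', LinearMap.neg_apply, neg_le_neg_iff]
  constructor
  · intro h y hy
    have := hlin x y
    have := hnn y hy
    linarith
  · intro h
    have h1 := h x₀ hx₀.1
    have h2 := hlin x x₀
    have h3 := hnn x hx
    have h4 := hx₀.2
    linarith

theorem exists_zeroSet_of_isExposed {p : I → Vec D} {F : Set (Vec D)}
    (hF : IsExposed ℝ (convexHull ℝ (Set.range p)) F) (hne : F.Nonempty) :
    ∃ f : Vec D →ᵃ[ℝ] ℝ, (∀ i, 0 ≤ f (p i)) ∧
      F = convexHull ℝ (p '' (zeroSet fun i => f (p i))) := by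
  obtain ⟨l, hl⟩ := hF hne
  obtain ⟨x₀, hx₀⟩ := hne
  rw [hl] at hx₀
  let f : Vec D →ᵃ[ℝ] ℝ :=
    AffineMap.const ℝ _ (l x₀) - (l : Vec D →ₗ[ℝ] ℝ).toAffineMap
  have hfx : ∀ x, f x = l x₀ - l x := fun x => rfl
  have hf : ∀ i, 0 ≤ f (p i) := fun i => by
    rw [hfx]
    exact sub_nonneg.2 (hx₀.2 _ (subset_convexHull ℝ _ ⟨i, rfl⟩))
  refine ⟨f, hf, ?_⟩
  rw [convexHull_image_zeroSet hf, hl]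
  ext x
  refine and_congr_right fun hx => ?_
  rw [hfx]
  constructor
  · intro h
    linarith [h x₀ hx₀.1, hx₀.2 x hx]
  · intro h y hy
    linarith [hx₀.2 y hy]

end Faces

/-- `Fin.append` as a linear map. -/
def appendLinear (m n : ℕ) : Vec m × Vec n →ₗ[ℝ] Vec (m + n) where
  toFun p := Fin.append p.1 p.2
  map_add' p q := by
    ext i
    refine Fin.addCases (fun j => ?_) (fun j => ?_) i <;> simp
  map_smul' c p := by
    ext i
    refine Fin.addCases (fun j => ?_) (fun j => ?_) i <;> simp

/-- The barycentric coordinates of the first factor of `ℝ^{2+d}` with respect to `e2`. -/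
def bary (d : ℕ) : Fin 3 → Vec (2 + d) →ᵃ[ℝ] ℝ :=
  let c : Fin 2 → Vec (2 + d) →ᵃ[ℝ] ℝ := fun j =>
    (LinearMap.proj (Fin.castAdd d j) : Vec (2 + d) →ₗ[ℝ] ℝ).toAffineMap
  ![AffineMap.const ℝ _ 1 - c 0 - c 1, c 0, c 1]

theorem bary_cayEmb (d : ℕ) (i j : Fin 3) (v : Vec d) :
    bary d i (cayEmb d j v) = if j = i then 1 else 0 := by
  fin_cases i <;> fin_cases j <;> simp [bary, cayEmb, e2, -Fin.castAdd_zero]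

namespace Cayley3

variable {d : ℕ} (Γ : Cayley3 d)

/-- The vertices of the Cayley polytope, indexed by the three summands. -/
abbrev Idx := (i : Fin 3) × Γ.V i

def pt (z : Γ.Idx) : Vec (2 + d) := cayEmb d z.1 z.2

theorem coe_VV (i : Fin 3) : (Γ.VV i : Set (Vec (2 + d))) = Γ.pt '' {z | z.1 = i} := by
  ext x
  simp only [VV, coe_image, Set.mem_image, mem_coe, Set.mem_ofPred_eq]
  constructor
  · rintro ⟨v, hv, rfl⟩
    exact ⟨⟨i, v, hv⟩, rfl, rfl⟩
  · rintro ⟨⟨j, v, hv⟩, rfl, rfl⟩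
    exact ⟨v, hv, rfl⟩

theorem CayR_eq (R : Finset (Fin 3)) :
    Γ.CayR R = convexHull ℝ (Γ.pt '' {z | z.1 ∈ R}) := by
  unfold CayR
  congr 1
  ext x
  simp only [coe_biUnion, coe_VV, Set.mem_iUnion, Set.mem_image, Set.mem_ofPred_eq, mem_coe]
  constructor
  · rintro ⟨i, hi, z, rfl, rfl⟩
    exact ⟨z, hi, rfl⟩
  · rintro ⟨z, hz, rfl⟩
    exact ⟨z.1, hz, z, rfl, rfl⟩

theorem Cay_eq_CayR : Γ.Cay = Γ.CayR univ := by
  unfold Cay CayR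
  congr 2
  ext x
  simp [Fin.exists_fin_succ]

theorem Cay_eq : Γ.Cay = convexHull ℝ (Set.range Γ.pt) := by
  rw [Cay_eq_CayR, CayR_eq]
  congr 1
  ext x
  simp

theorem convexPosition_pt : ConvexPosition Γ.pt := by
  classical
  rintro ⟨i, v, hv⟩ hmem
  let f : Vec (2 + d) →ᵃ[ℝ] ℝ := AffineMap.const ℝ _ 1 - bary d i
  have h1 : ∀ z : Γ.Idx, f (Γ.pt z) = if z.1 = i then 0 else 1 := fun z => by
    have : f (Γ.pt z) = 1 - bary d i (Γ.pt z) := rfl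
    rw [this, pt, bary_cayEmb]
    split_ifs <;> norm_num
  have h2 := (nonneg_and_mem_convexHull_of_eq_zero (f := f) (by
    rintro _ ⟨z, -, rfl⟩
    rw [h1]
    split_ifs <;> norm_num) hmem).2 (by rw [h1, if_pos rfl])
  let π : Vec (2 + d) →ᵃ[ℝ] Vec d := (LinearMap.funLeft ℝ ℝ (Fin.natAdd 2)).toAffineMap
  have hπ : ∀ z : Γ.Idx, π (Γ.pt z) = z.2 := fun z => by
    ext j
    simp [π, pt, cayEmb, LinearMap.funLeft]
  have h3 := Set.mem_image_of_mem π h2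
  rw [AffineMap.image_convexHull, hπ] at h3
  refine (Γ.hvert i).2 v hv (convexHull_mono ?_ h3)
  rintro _ ⟨_, ⟨⟨⟨j, v', hv'⟩, hne, rfl⟩, h0⟩, rfl⟩
  rw [h1] at h0
  obtain rfl : j = i := by
    by_contra h
    simp [h] at h0
  rw [hπ]
  simp only [coe_erase, Set.mem_sdiff, mem_coe, Set.mem_singleton_iff]
  refine ⟨hv', ?_⟩
  rintro rfl
  exact hne rfl

theorem affineSpan_V (i : Fin 3) : affineSpan ℝ (Γ.V i : Set (Vec d)) = ⊤ := by
  have h := Γ.hdim i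
  unfold sdim at h
  split_ifs at h with h0
  rw [affineSpan_convexHull] at h
  have hne : (Γ.V i : Set (Vec d)).Nonempty := by
    rwa [← Ne, ← Set.nonempty_iff_ne_empty, convexHull_nonempty_iff] at h0
  rw [← AffineSubspace.direction_eq_top_iff_of_nonempty ((affineSpan_nonempty ℝ).2 hne)]
  apply Submodule.eq_top_of_finrank_eq
  simpa using h

theorem eq_zero_of_forall_pt {f : Vec (2 + d) →ᵃ[ℝ] ℝ} (hf : ∀ z, f (Γ.pt z) = 0) : f = 0 := by
  have h1 : ∀ i b, f (Fin.append (e2 i) b) = 0 := by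
    intro i b
    let g : Vec d →ᵃ[ℝ] ℝ := f.comp ((appendLinear 2 d).toAffineMap.comp
      ((AffineMap.const ℝ _ (e2 i)).prod (AffineMap.id ℝ _)))
    have hg : g = 0 := AffineMap.ext_on (Γ.affineSpan_V i) fun v hv => hf ⟨i, v, hv⟩
    exact congrArg (fun g : Vec d →ᵃ[ℝ] ℝ => g b) hg
  let h : Vec 2 × Vec d →ᵃ[ℝ] ℝ := f.comp (appendLinear 2 d).toAffineMap
  have hh : ∀ i b, h (e2 i, b) = 0 := h1
  have hall : ∀ a b, h (a, b) = 0 := by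
    intro a b
    have h2 : ∀ x y, h.linear (x - y) = h x - h y := fun x y => by
      simpa using h.linearMap_vsub x y
    have h3 : (a, b) - (e2 0, b) =
        a 0 • ((e2 1, b) - (e2 0, b)) + a 1 • ((e2 2, b) - (e2 0, b)) := by
      ext j
      · fin_cases j <;> simp [e2] <;> rfl
      · simp
    have h4 := h2 (a, b) (e2 0, b)
    rw [h3, map_add, map_smul, map_smul, h2, h2, hh, hh, hh] at h4
    simpa using h4.symm
  refine AffineMap.ext fun x => ?_
  have h5 := hall (fun i => x (Fin.castAdd d i)) (fun i => x (Fin.natAdd 2 i))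
  have h6 : h (fun i => x (Fin.castAdd d i), fun i => x (Fin.natAdd 2 i)) = f x := by
    simp [h, appendLinear, Fin.append_castAdd_natAdd]
  rw [← h6, h5]
  rfl

theorem finrank_affineValues_pt : Module.finrank ℝ (affineValues Γ.pt) = d + 2 + 1 := by
  rw [finrank_affineValues fun f hf => Γ.eq_zero_of_forall_pt hf]
  simp [add_comm]

def Transversal (L : Finset Γ.Idx) : Prop := ∀ i, ∃ z ∈ L, z.1 = i

variable {Γ}

theorem transversal_of_nonFace {L : Finset Γ.Idx} (hL : NonFace (affineValues Γ.pt) L) :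
    Γ.Transversal L := by
  intro i
  by_contra! h
  have h1 := hL _ ⟨bary d i, rfl⟩ (fun z => by
    change 0 ≤ bary d i (cayEmb d z.1 z.2)
    rw [bary_cayEmb]
    split_ifs <;> norm_num) fun z hz => by
    change bary d i (cayEmb d z.1 z.2) = 0
    rw [bary_cayEmb, if_neg (h z hz)]
  obtain ⟨v, hv⟩ := Finset.card_pos.1 (Nat.zero_lt_of_lt (Γ.hcard i))
  have h2 : bary d i (cayEmb d i v) = 0 := congrFun h1 ⟨i, v, hv⟩
  rw [bary_cayEmb, if_pos rfl] at h2
  exact one_ne_zero h2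

theorem isProperFace_zeroSet {f : Vec (2 + d) →ᵃ[ℝ] ℝ} (hf : ∀ z, 0 ≤ f (Γ.pt z))
    (hne : ∃ z, f (Γ.pt z) ≠ 0) (hZ : (zeroSet fun z => f (Γ.pt z)).Nonempty) :
    IsProperFace Γ.Cay (convexHull ℝ (Γ.pt '' (zeroSet fun z => f (Γ.pt z)))) := by
  rw [Cay_eq]
  refine ⟨isExposed_convexHull_zeroSet hf, ?_, fun h => ?_⟩
  · rw [convexHull_nonempty_iff]
    exact Set.image_nonempty.2 hZ
  · obtain ⟨z, hz⟩ := hne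
    have h1 : Γ.pt z ∈ convexHull ℝ (Set.range Γ.pt) := subset_convexHull ℝ _ ⟨z, rfl⟩
    rw [← h, Γ.convexPosition_pt.mem_convexHull_iff] at h1
    exact hz ((mem_zeroSet (l := fun z => f (Γ.pt z))).1 h1)

theorem affineIndependent_zeroSet (hsimp : Γ.Simplicial) {f : Vec (2 + d) →ᵃ[ℝ] ℝ}
    (hf : ∀ z, 0 ≤ f (Γ.pt z)) (hne : ∃ z, f (Γ.pt z) ≠ 0)
    (hZ : Γ.Transversal (zeroSet fun z => f (Γ.pt z))) :
    AffineIndependent ℝ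
      (fun v : Γ.pt '' (zeroSet fun z => f (Γ.pt z)) => (v : Vec (2 + d))) := by
  have hface := isProperFace_zeroSet hf hne ((hZ 0).imp fun z hz => hz.1)
  obtain ⟨A, hA, hFA⟩ := hsimp _ hface fun R _ hR => by
    by_cases hRu : R = univ
    · subst hRu
      exact hface.2.2 (hR.trans Γ.Cay_eq_CayR.symm)
    · obtain ⟨i, hi⟩ : ∃ i, i ∉ R := by
        by_contra! h
        exact hRu (Finset.eq_univ_of_forall h)
      obtain ⟨z, hz, rfl⟩ := hZ i
      have h1 := Γ.convexPosition_pt.mem_convexHull_iff.2 (mem_coe.2 hz)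
      rw [hR, CayR_eq, Γ.convexPosition_pt.mem_convexHull_iff] at h1
      exact hi h1
  exact Γ.convexPosition_pt.affineIndependent (A := (A : Set (Vec (2 + d)))) hA hFA

/-- A transversal set on which some nonzero nonnegative affine function vanishes spans a simplex
in `ℱ_{[3]}`. -/
theorem convexHull_mem_FSet (hsimp : Γ.Simplicial) {L : Finset Γ.Idx} (hL : Γ.Transversal L)
    (hnf : ¬ NonFace (affineValues Γ.pt) L) :
    convexHull ℝ (Γ.pt '' L) ∈ Γ.FSet univ ∧
      sdim (convexHull ℝ (Γ.pt '' L)) = (L.card : ℤ) - 1 := by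
  unfold NonFace at hnf
  push Not at hnf
  obtain ⟨_, ⟨f, rfl⟩, hf, hfL, hne⟩ := hnf
  change ∀ z, 0 ≤ f (Γ.pt z) at hf
  change ∀ z ∈ L, f (Γ.pt z) = 0 at hfL
  have hne : ∃ z, f (Γ.pt z) ≠ 0 := Function.ne_iff.1 hne
  have hLZ : L ⊆ zeroSet fun z => f (Γ.pt z) := fun z hz => mem_zeroSet.2 (hfL z hz)
  have hind := affineIndependent_zeroSet hsimp hf hne fun i =>
    (hL i).imp fun z hz => ⟨hLZ hz.1, hz.2⟩
  obtain ⟨g, hg, rfl⟩ := exists_zeroSet_eq_of_subset Γ.convexPosition_pt.injective hf hLZ hind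
  have hgne : ∃ z, g (Γ.pt z) ≠ 0 := by
    obtain ⟨z, hz⟩ := hne
    exact ⟨z, fun h => hz ((mem_zeroSet (l := fun z => f (Γ.pt z))).1
      (hLZ (mem_zeroSet.2 h)))⟩
  refine ⟨⟨isProperFace_zeroSet hg hgne ((hL 0).imp fun z hz => hz.1), fun i _ => ?_⟩,
    sdim_convexHull_image Γ.convexPosition_pt.injective
      (hind.mono (Set.image_mono (coe_subset.2 hLZ)))⟩
  obtain ⟨z, hz, hzi⟩ := hL i
  refine ⟨Γ.pt z, subset_convexHull ℝ _ ⟨z, hz, rfl⟩, ?_⟩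
  rw [coe_VV]
  exact ⟨z, hzi, rfl⟩

theorem exists_of_mem_FSet {F : Set (Vec (2 + d))} (hF : F ∈ Γ.FSet univ) :
    ∃ L : Finset Γ.Idx, Γ.Transversal L ∧ ¬ NonFace (affineValues Γ.pt) L ∧
      F = convexHull ℝ (Γ.pt '' L) := by
  obtain ⟨⟨hexp, hne, hF⟩, hmeet⟩ := hF
  rw [Cay_eq] at hexp hF
  obtain ⟨f, hf, rfl⟩ := exists_zeroSet_of_isExposed hexp hne
  refine ⟨_, fun i => ?_, fun hnf => hF ?_, rfl⟩
  · obtain ⟨x, hx, hxi⟩ := hmeet i (mem_univ i)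
    rw [coe_VV] at hxi
    obtain ⟨z, hzi, rfl⟩ := hxi
    exact ⟨z, Γ.convexPosition_pt.mem_convexHull_iff.1 hx, hzi⟩
  · have h0 := hnf _ ⟨f, rfl⟩ hf fun z hz => mem_zeroSet.1 hz
    have hu : ((zeroSet fun z => f (Γ.pt z) : Finset Γ.Idx) : Set Γ.Idx) = Set.univ :=
      Set.eq_univ_of_forall fun z => mem_zeroSet.2 (congrFun h0 z)
    rw [hu, Set.image_univ]

open scoped Classical in
theorem fsetCount_FSet_univ (hsimp : Γ.Simplicial) (l : ℕ) :
    fsetCount (Γ.FSet univ) ((l : ℤ) - 1) =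
      (univ.filter fun L : Finset Γ.Idx =>
        L.card = l ∧ Γ.Transversal L ∧ ¬ NonFace (affineValues Γ.pt) L).card := by
  unfold fsetCount
  rw [← Fintype.card_subtype, ← Nat.card_eq_fintype_card]
  let toFace : {L : Finset Γ.Idx //
      L.card = l ∧ Γ.Transversal L ∧ ¬ NonFace (affineValues Γ.pt) L} →
      {F // F ∈ Γ.FSet univ ∧ sdim F = (l : ℤ) - 1} := fun L =>
    ⟨convexHull ℝ (Γ.pt '' L.1), by
      obtain ⟨h1, h2⟩ := convexHull_mem_FSet hsimp L.2.2.1 L.2.2.2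
      exact ⟨h1, by rw [h2, L.2.1]⟩⟩
  refine (Nat.card_eq_of_bijective toFace ⟨?_, ?_⟩).symm
  · intro L M h
    have h1 := congrArg Subtype.val h
    ext z
    change convexHull ℝ (Γ.pt '' L.1) = convexHull ℝ (Γ.pt '' M.1) at h1
    rw [← mem_coe, ← mem_coe, ← Γ.convexPosition_pt.mem_convexHull_iff, h1,
      Γ.convexPosition_pt.mem_convexHull_iff]
  · rintro ⟨F, hF, hdim⟩
    obtain ⟨L, h1, h2, rfl⟩ := exists_of_mem_FSet hF
    refine ⟨⟨L, ?_, h1, h2⟩, rfl⟩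
    rw [(convexHull_mem_FSet hsimp h1 h2).2] at hdim
    omega

theorem sum_neg_one_pow_of_subset (T : Finset (Fin 3)) (hT : T ≠ ∅) :
    (∑ S ∈ (univ : Finset (Fin 3)).powerset.filter (· ≠ ∅),
      (-1 : ℤ) ^ (3 - S.card) * if T ⊆ S then 1 else 0) = if T = univ then 1 else 0 := by
  revert T
  decide

variable (Γ) in
/-- The value of `f_{l-1}(ℱ_{[3]})` when every transversal `l`-set spans a face. -/
def maxCount (l : ℤ) : ℤ :=
  ∑ S ∈ (univ : Finset (Fin 3)).powerset.filter (· ≠ ∅),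
    (-1 : ℤ) ^ (3 - S.card) * ch (∑ j ∈ S, ((Γ.V j).card : ℤ)) l

theorem card_filter_forall_mem (S : Finset (Fin 3)) (l : ℕ) :
    (univ.filter fun L : Finset Γ.Idx => L.card = l ∧ ∀ z ∈ L, z.1 ∈ S).card =
      (∑ j ∈ S, (Γ.V j).card).choose l := by
  have h1 : (univ.filter fun z : Γ.Idx => z.1 ∈ S) = S.sigma fun _ => univ := by
    ext z
    simp
  have h2 : (univ.filter fun z : Γ.Idx => z.1 ∈ S).card = ∑ j ∈ S, (Γ.V j).card := by
    rw [h1, Finset.card_sigma]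
    simp
  rw [← h2, ← Finset.card_powersetCard]
  congr 1
  ext L
  simp [mem_powersetCard, subset_iff, and_comm]

open scoped Classical in
theorem maxCount_eq {l : ℕ} (hl : l ≠ 0) :
    Γ.maxCount l =
      (univ.filter fun L : Finset Γ.Idx => L.card = l ∧ Γ.Transversal L).card := by
  have h1 : ∀ S : Finset (Fin 3), ch (∑ j ∈ S, ((Γ.V j).card : ℤ)) l =
      ∑ L ∈ univ.filter (fun L : Finset Γ.Idx => L.card = l),
        if L.image Sigma.fst ⊆ S then 1 else 0 := fun S => by
    rw [← Nat.cast_sum, ch_natCast, ← card_filter_forall_mem, Finset.sum_boole,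
      Finset.filter_filter]
    simp only [image_subset_iff]
  unfold maxCount
  simp only [h1, Finset.mul_sum]
  rw [Finset.sum_comm, ← Finset.filter_filter, Finset.card_filter]
  push_cast
  refine Finset.sum_congr rfl fun L hL => ?_
  rw [mem_filter] at hL
  have hne : L.image Sigma.fst ≠ ∅ := by
    rw [Ne, Finset.image_eq_empty]
    rintro rfl
    exact hl (by simpa using hL.2.symm)
  rw [sum_neg_one_pow_of_subset _ hne]
  have : L.image Sigma.fst = univ ↔ Γ.Transversal L := by
    simp [Finset.eq_univ_iff_forall, Transversal]
  simp only [this]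

theorem maxCount_zero : Γ.maxCount 0 = 1 := by
  simp only [maxCount, ch, le_refl, if_true, Int.toNat_zero, Ring.choose_zero_right]
  decide

open scoped Classical in
theorem fF_univ_eq (hsimp : Γ.Simplicial) {l : ℕ} (hl : l ≤ d + 2) :
    Γ.fF univ ((l : ℤ) - 1) = Γ.maxCount l -
      (univ.filter fun L : Finset Γ.Idx =>
        L.card = l ∧ NonFace (affineValues Γ.pt) L).card := by
  have hcard : ((univ : Finset (Fin 3)).card : ℤ) = 3 := by simp
  unfold fF
  rw [if_neg (by rw [hcard]; omega)]
  rcases Nat.eq_zero_or_pos l with rfl | hpos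
  · have h0 : (univ.filter fun L : Finset Γ.Idx =>
        L.card = 0 ∧ NonFace (affineValues Γ.pt) L).card = 0 := by
      rw [Finset.card_eq_zero, Finset.filter_eq_empty_iff]
      rintro L - ⟨h1, h2⟩
      obtain ⟨z, hz, -⟩ := transversal_of_nonFace h2 0
      rw [Finset.card_eq_zero.1 h1] at hz
      exact Finset.notMem_empty z hz
    rw [h0]
    simp [maxCount_zero]
  · rw [if_neg (by omega), fsetCount_FSet_univ hsimp, maxCount_eq hpos.ne', eq_sub_iff_add_eq,
      ← Nat.cast_add, Nat.cast_inj, ← Finset.card_union_of_disjoint]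
    · congr 1
      ext L
      simp only [mem_union, mem_filter, mem_univ, true_and]
      have := transversal_of_nonFace (L := L)
      tauto
    · rw [Finset.disjoint_filter]
      tauto

theorem hSum_maxCount {k : ℕ} (hk : k ≤ d + 2) :
    hSum (d + 2) k (fun l => Γ.maxCount l) =
      ∑ S ∈ (univ : Finset (Fin 3)).powerset.filter (· ≠ ∅),
        (-1 : ℤ) ^ (3 - S.card) *
          ch ((∑ j ∈ S, ((Γ.V j).card : ℤ)) - (d : ℤ) - 3 + k) k := by
  unfold maxCount
  rw [hSum_sum]
  refine Finset.sum_congr rfl fun S _ => ?_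
  congr 1
  rw [← Nat.cast_sum]
  simp only [ch_natCast]
  rw [hSum_choose hk, ch, if_pos (by omega), Int.toNat_natCast]
  congr 1
  push_cast
  ring

open scoped Classical in
theorem hF_univ_eq (hsimp : Γ.Simplicial) {k : ℕ} (hk : k ≤ d + 2) :
    hF (Γ.fF univ) ((d : ℤ) + 1) k =
      (∑ S ∈ (univ : Finset (Fin 3)).powerset.filter (· ≠ ∅),
        (-1 : ℤ) ^ (3 - S.card) *
          ch ((∑ j ∈ S, ((Γ.V j).card : ℤ)) - (d : ℤ) - 3 + k) k) -
      hSum (d + 2) k (fun l => ((univ.filter fun L : Finset Γ.Idx =>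
        L.card = l ∧ NonFace (affineValues Γ.pt) L).card : ℤ)) := by
  rw [← hSum_maxCount hk, ← hSum_sub, ← hSum_congr fun l hl => fF_univ_eq hsimp hl]
  unfold hF hSum
  rw [show ((d : ℤ) + 1 + 2).toNat = d + 2 + 1 by omega,
    show (d : ℤ) + 1 + 1 = (d + 2 : ℕ) by push_cast; ring]

end Cayley3

/-- Lemma `lem:hkWbound`. For all `0 ≤ k ≤ d+2`,
`h_k(ℱ_{[3]}) ≤ ∑_{∅⊂S⊆[3]} (-1)^{3-|S|} C(n_S-d-3+k, k)`; and for
`0 ≤ k ≤ ⌊(d+2)/2⌋` equality holds iff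
`f_{l-1}(ℱ_{[3]}) = ∑_{∅⊂S⊆[3]} (-1)^{3-|S|} C(n_S, l)` for all `0 ≤ l ≤ k`. -/
theorem h_vector_bound_F3
    (d : ℕ) (Γ : Cayley3 d) (hsimp : Γ.Simplicial) :
    (∀ k : ℤ, 0 ≤ k → k ≤ (d : ℤ) + 2 →
      hF (Γ.fF Finset.univ) ((d : ℤ) + 1) k ≤
        ∑ S ∈ (Finset.univ : Finset (Fin 3)).powerset.filter (· ≠ ∅),
          (-1 : ℤ) ^ (3 - S.card) *
            ch ((∑ j ∈ S, ((Γ.V j).card : ℤ)) - (d : ℤ) - 3 + k) k) ∧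
    (∀ k : ℤ, 0 ≤ k → k ≤ (((d + 2) / 2 : ℕ) : ℤ) →
      (hF (Γ.fF Finset.univ) ((d : ℤ) + 1) k =
          ∑ S ∈ (Finset.univ : Finset (Fin 3)).powerset.filter (· ≠ ∅),
            (-1 : ℤ) ^ (3 - S.card) *
              ch ((∑ j ∈ S, ((Γ.V j).card : ℤ)) - (d : ℤ) - 3 + k) k ↔
        ∀ l : ℤ, 0 ≤ l → l ≤ k →
          Γ.fF Finset.univ (l - 1) =
            ∑ S ∈ (Finset.univ : Finset (Fin 3)).powerset.filter (· ≠ ∅),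
              (-1 : ℤ) ^ (3 - S.card) * ch (∑ j ∈ S, ((Γ.V j).card : ℤ)) l)) := by
  classical
  obtain ⟨w, hw⟩ := exists_intervalPartition_nonFace (affineValues Γ.pt)
  rw [Γ.finrank_affineValues_pt] at hw
  refine ⟨fun k hk0 hk => ?_, fun k hk0 hk => ?_⟩
  · lift k to ℕ using hk0
    have hk' : k ≤ d + 2 := by omega
    rw [Cayley3.hF_univ_eq hsimp hk']
    exact sub_le_self _ (hw.hSum_nonneg hk').1
  · lift k to ℕ using hk0
    have hk' : k ≤ d + 2 := by omega
    rw [Cayley3.hF_univ_eq hsimp hk', sub_eq_self, (hw.hSum_nonneg hk').2]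
    have hl : ∀ l ≤ k, ((univ.filter fun L : Finset Γ.Idx =>
        L.card = l ∧ NonFace (affineValues Γ.pt) L).card = 0 ↔
        Γ.fF univ ((l : ℤ) - 1) = Γ.maxCount l) := fun l hl => by
      rw [Cayley3.fF_univ_eq hsimp (hl.trans hk'), sub_eq_self, Nat.cast_eq_zero]
    constructor
    · intro h l hl0 hlk
      lift l to ℕ using hl0
      exact (hl l (by omega)).1 (h l (by omega))
    · intro h l hlk
      exact (hl l hlk).2 (h l (by omega) (by omega))
end
end
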